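/- Let Ω be a bounded domain in ℝ^N with boundary Γ, fix 1 ≤ p ≤ ∞ and ε > 0 such that Ω contains a ball of radius ε, let g ∈ C(Γ), and assume all points of Γ are regular, so that the unique solution u^ε of the Dirichlet-type problem exists and equals both Perron solutions. Let w be any function on the closure of Ω with u̲^ε ≤ w ≤ u̅^ε there, and define the iteration w₁ = w, w_{j+1} = μ_p^ε[w_j] on the closure of Ω for j ≥ 1. Then w_j converges pointwise to u^ε = u̲^ε = u̅^ε on the closure of Ω as j → ∞. -/

import Mathlib

open MeasureTheory Filter Topology Metric
open scoped ENNReal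

noncomputable section

/-- The variational `p`-mean predicate: `m` minimizes the (normalized) `L^p` distance of `v`
to constants, with respect to the measure `μ`. -/
def IsPMean {N : ℕ} (p : ℝ≥0∞) (μ : Measure (EuclideanSpace ℝ (Fin N)))
    (v : EuclideanSpace ℝ (Fin N) → ℝ) (m : ℝ) : Prop :=
  ∀ ν : ℝ, eLpNorm (fun x => v x - m) p μ ≤ eLpNorm (fun x => v x - ν) p μ

/-- The `p`-mean of `v` with respect to `μ` (chosen among the minimizers). -/
def pMean {N : ℕ} (p : ℝ≥0∞) (μ : Measure (EuclideanSpace ℝ (Fin N)))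
    (v : EuclideanSpace ℝ (Fin N) → ℝ) : ℝ :=
  Classical.epsilon (IsPMean p μ v)

/-- `r_ε(x) = min (ε, dist(x, ∂Ω))`. -/
def rEps {N : ℕ} (ε : ℝ) (Ω : Set (EuclideanSpace ℝ (Fin N))) (x : EuclideanSpace ℝ (Fin N)) : ℝ :=
  min ε (Metric.infDist x (frontier Ω))

open Classical in
/-- The operator `μ_p^ε`: the `p`-mean of `v` on the ball `B_{r_ε(x)}(x)` for `x ∈ Ω`,
and `v x` itself outside of `Ω` (in particular on the boundary, where `r_ε = 0`). -/
def muEps {N : ℕ} (p : ℝ≥0∞) (ε : ℝ) (Ω : Set (EuclideanSpace ℝ (Fin N)))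
    (v : EuclideanSpace ℝ (Fin N) → ℝ) (x : EuclideanSpace ℝ (Fin N)) : ℝ :=
  if x ∈ Ω then pMean p (volume.restrict (Metric.ball x (rEps ε Ω x))) v else v x

/-- The class `S_g` of variational `p`-subsolutions of the Dirichlet-type problem:
continuous on `closure Ω`, `v ≤ μ_p^ε[v]` in `Ω`, and `v ≤ g` on `Γ = ∂Ω`. -/
def SgLower {N : ℕ} (p : ℝ≥0∞) (ε : ℝ) (Ω : Set (EuclideanSpace ℝ (Fin N)))
    (g : EuclideanSpace ℝ (Fin N) → ℝ) : Set (EuclideanSpace ℝ (Fin N) → ℝ) :=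
  {v | ContinuousOn v (closure Ω) ∧ (∀ x ∈ Ω, v x ≤ muEps p ε Ω v x) ∧
    ∀ x ∈ frontier Ω, v x ≤ g x}

/-- The class `S^g` of variational `p`-supersolutions of the Dirichlet-type problem:
continuous on `closure Ω`, `v ≥ μ_p^ε[v]` in `Ω`, and `v ≥ g` on `Γ = ∂Ω`. -/
def SgUpper {N : ℕ} (p : ℝ≥0∞) (ε : ℝ) (Ω : Set (EuclideanSpace ℝ (Fin N)))
    (g : EuclideanSpace ℝ (Fin N) → ℝ) : Set (EuclideanSpace ℝ (Fin N) → ℝ) :=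
  {v | ContinuousOn v (closure Ω) ∧ (∀ x ∈ Ω, muEps p ε Ω v x ≤ v x) ∧
    ∀ x ∈ frontier Ω, g x ≤ v x}

/-- The lower Perron solution `u̲^ε(x) = sup_{v ∈ S_g} v(x)`. -/
def lowerPerron {N : ℕ} (p : ℝ≥0∞) (ε : ℝ) (Ω : Set (EuclideanSpace ℝ (Fin N)))
    (g : EuclideanSpace ℝ (Fin N) → ℝ) (x : EuclideanSpace ℝ (Fin N)) : ℝ :=
  sSup ((fun v => v x) '' SgLower p ε Ω g)

/-- The upper Perron solution `u̅^ε(x) = inf_{w ∈ S^g} w(x)`. -/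
def upperPerron {N : ℕ} (p : ℝ≥0∞) (ε : ℝ) (Ω : Set (EuclideanSpace ℝ (Fin N)))
    (g : EuclideanSpace ℝ (Fin N) → ℝ) (x : EuclideanSpace ℝ (Fin N)) : ℝ :=
  sInf ((fun v => v x) '' SgUpper p ε Ω g)

/-- A barrier at `x₀ ∈ Γ` for the Dirichlet-type problem: a continuous function on
`closure Ω`, variationally `p`-superharmonious in `Ω`, positive on `closure Ω ∖ {x₀}`,
vanishing at `x₀`. A boundary point admitting a barrier is called regular. -/
def IsBarrier {N : ℕ} (p : ℝ≥0∞) (ε : ℝ) (Ω : Set (EuclideanSpace ℝ (Fin N)))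
    (x₀ : EuclideanSpace ℝ (Fin N)) (w : EuclideanSpace ℝ (Fin N) → ℝ) : Prop :=
  ContinuousOn w (closure Ω) ∧ (∀ x ∈ Ω, muEps p ε Ω w x ≤ w x) ∧
    (∀ x ∈ closure Ω, x ≠ x₀ → 0 < w x) ∧ w x₀ = 0

/-- A solution of the Dirichlet-type problem `u = μ_p^ε[u]` in `Ω`, `u = g` on `Γ`,
of class `C(closure Ω)`. -/
def IsDirichletSolution {N : ℕ} (p : ℝ≥0∞) (ε : ℝ) (Ω : Set (EuclideanSpace ℝ (Fin N)))
    (g u : EuclideanSpace ℝ (Fin N) → ℝ) : Prop :=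
  ContinuousOn u (closure Ω) ∧ (∀ x ∈ Ω, u x = muEps p ε Ω u x) ∧
    ∀ x ∈ frontier Ω, u x = g x

/-- The odd power `|t|^(q-2) t`, taken right-continuous when `q = 1`. -/
def signedPow (q t : ℝ) : ℝ := if 0 ≤ t then t ^ (q - 1) else -((-t) ^ (q - 1))

lemma signedPow_of_nonneg {q t : ℝ} (ht : 0 ≤ t) : signedPow q t = t ^ (q - 1) := if_pos ht

lemma signedPow_of_neg {q t : ℝ} (ht : t < 0) : signedPow q t = -((-t) ^ (q - 1)) :=
  if_neg (not_le.2 ht)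

lemma signedPow_pos {q t : ℝ} (ht : 0 < t) : 0 < signedPow q t := by
  rw [signedPow_of_nonneg ht.le]; positivity

lemma signedPow_neg_of_neg {q t : ℝ} (ht : t < 0) : signedPow q t < 0 := by
  rw [signedPow_of_neg ht]
  have : 0 < -t := by linarith
  have := Real.rpow_pos_of_pos this (q - 1)
  linarith

lemma signedPow_mono {q : ℝ} (hq : 1 ≤ q) : Monotone (signedPow q) := by
  intro s t hst
  rcases le_or_gt 0 s with hs | hs
  · rw [signedPow_of_nonneg hs, signedPow_of_nonneg (hs.trans hst)]
    exact Real.rpow_le_rpow hs hst (by linarith)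
  · rcases le_or_gt 0 t with ht | ht
    · refine (signedPow_neg_of_neg hs).le.trans ?_
      rw [signedPow_of_nonneg ht]; positivity
    · rw [signedPow_of_neg hs, signedPow_of_neg ht, neg_le_neg_iff]
      exact Real.rpow_le_rpow (by linarith) (by linarith) (by linarith)

lemma signedPow_zero {q : ℝ} (hq : 1 < q) : signedPow q 0 = 0 := by
  rw [signedPow_of_nonneg le_rfl, Real.zero_rpow (by linarith)]

lemma signedPow_strictMono {q : ℝ} (hq : 1 < q) : StrictMono (signedPow q) := by
  intro s t hst
  rcases le_or_gt 0 s with hs | hs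
  · rw [signedPow_of_nonneg hs, signedPow_of_nonneg (hs.trans hst.le)]
    exact Real.rpow_lt_rpow hs hst (by linarith)
  · rcases le_or_gt 0 t with ht | ht
    · refine (signedPow_neg_of_neg hs).trans_le ?_
      rw [signedPow_of_nonneg ht]; positivity
    · rw [signedPow_of_neg hs, signedPow_of_neg ht, neg_lt_neg_iff]
      exact Real.rpow_lt_rpow (by linarith) (by linarith) (by linarith)

lemma signedPow_neg {q : ℝ} (hq : 1 < q) (t : ℝ) : signedPow q (-t) = -signedPow q t := by
  rcases lt_trichotomy t 0 with ht | rfl | ht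
  · rw [signedPow_of_neg ht, signedPow_of_nonneg (by linarith), neg_neg]
  · rw [neg_zero, signedPow_zero hq, neg_zero]
  · rw [signedPow_of_neg (by linarith : -t < 0), signedPow_of_nonneg ht.le, neg_neg]

lemma tendsto_signedPow {q : ℝ} (hq : 1 ≤ q) {u : ℕ → ℝ} {t : ℝ}
    (hu : Tendsto u atTop (𝓝 t)) (hut : ∀ n, t ≤ u n) :
    Tendsto (fun n => signedPow q (u n)) atTop (𝓝 (signedPow q t)) := by
  rcases le_or_gt 0 t with ht | ht
  · rw [signedPow_of_nonneg ht]
    simp_rw [fun n => signedPow_of_nonneg (q := q) (ht.trans (hut n))]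
    exact (Real.continuousAt_rpow_const t (q - 1) (Or.inr (by linarith))).tendsto.comp hu
  · rw [signedPow_of_neg ht]
    have h : Tendsto (fun n => -((-(u n)) ^ (q - 1))) atTop (𝓝 (-((-t) ^ (q - 1)))) :=
      ((Real.continuousAt_rpow_const (-t) (q - 1) (Or.inr (by linarith))).tendsto.comp hu.neg).neg
    refine h.congr' ?_
    filter_upwards [hu.eventually_lt_const ht] with n hn
    rw [signedPow_of_neg hn]

lemma rpow_add_mul_le_rpow {q a b : ℝ} (hq : 1 ≤ q) (ha : 0 ≤ a) (hb : 0 ≤ b) :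
    b ^ q + q * b ^ (q - 1) * (a - b) ≤ a ^ q := by
  rcases hb.eq_or_lt with rfl | hb
  · rcases hq.eq_or_lt with rfl | hq
    · simp
    · rw [Real.zero_rpow (by linarith), Real.zero_rpow (by linarith)]
      simpa using Real.rpow_nonneg ha q
  · have h := one_add_mul_self_le_rpow_one_add (s := a / b - 1)
      (by linarith [div_nonneg ha hb.le]) hq
    have h2 : (1 + (a / b - 1)) ^ q = a ^ q / b ^ q := by
      rw [add_sub_cancel, Real.div_rpow ha hb.le]
    have hbq : 0 < b ^ q := Real.rpow_pos_of_pos hb q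
    rw [h2, le_div_iff₀ hbq] at h
    rw [Real.rpow_sub_one hb.ne']
    refine le_trans (le_of_eq ?_) h
    field_simp

lemma abs_rpow_add_mul_le {q : ℝ} (hq : 1 ≤ q) (s t : ℝ) :
    |t| ^ q + q * signedPow q t * (s - t) ≤ |s| ^ q := by
  have key := rpow_add_mul_le_rpow hq (abs_nonneg s) (abs_nonneg t)
  refine le_trans ?_ key
  rcases le_or_gt 0 t with ht | ht
  · rw [signedPow_of_nonneg ht, abs_of_nonneg ht]
    have : 0 ≤ q * t ^ (q - 1) := by positivity
    nlinarith [le_abs_self s]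
  · rw [signedPow_of_neg ht, abs_of_neg ht]
    have : 0 ≤ q * (-t) ^ (q - 1) := mul_nonneg (by linarith) (Real.rpow_nonneg (by linarith) _)
    nlinarith [neg_le_abs s]

lemma abs_signedPow_le {q C t : ℝ} (hq : 1 ≤ q) (h : |t| ≤ C) : |signedPow q t| ≤ C ^ (q - 1) := by
  have h1 : |signedPow q t| = |t| ^ (q - 1) := by
    rcases le_or_gt 0 t with ht | ht
    · rw [signedPow_of_nonneg ht, abs_of_nonneg ht, abs_of_nonneg (Real.rpow_nonneg ht _)]
    · rw [signedPow_of_neg ht, abs_of_neg ht, abs_neg,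
        abs_of_nonneg (Real.rpow_nonneg (by linarith) _)]
  rw [h1]
  exact Real.rpow_le_rpow (abs_nonneg t) h (by linarith)

section Integral

variable {α : Type*} [MeasurableSpace α] {μ : Measure α} [IsFiniteMeasure μ]

lemma integrable_signedPow {q C : ℝ} (hq : 1 ≤ q) {f : α → ℝ} (hf : AEMeasurable f μ)
    (hC : ∀ᵐ x ∂μ, |f x| ≤ C) (t : ℝ) : Integrable (fun x => signedPow q (f x - t)) μ := by
  refine Integrable.mono' (integrable_const ((C + |t|) ^ (q - 1))) ?_ ?_
  · exact ((signedPow_mono hq).measurable.comp_aemeasurable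
      (hf.sub_const t)).aestronglyMeasurable
  · filter_upwards [hC] with x hx
    exact abs_signedPow_le hq ((abs_sub _ _).trans (by linarith))

lemma integral_signedPow_mono {q C : ℝ} (hq : 1 ≤ q) {f h : α → ℝ} (hf : AEMeasurable f μ)
    (hC : ∀ᵐ x ∂μ, |f x| ≤ C) (hh : AEMeasurable h μ) (hC' : ∀ᵐ x ∂μ, |h x| ≤ C)
    (hfh : ∀ᵐ x ∂μ, f x ≤ h x) {s t : ℝ} (hst : s ≤ t) :
    ∫ x, signedPow q (f x - t) ∂μ ≤ ∫ x, signedPow q (h x - s) ∂μ := by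
  refine integral_mono_ae (integrable_signedPow hq hf hC t) (integrable_signedPow hq hh hC' s) ?_
  filter_upwards [hfh] with x hx
  exact signedPow_mono hq (by linarith)

/-- Nonnegativity of the integral passes to decreasing limits. -/
lemma integral_signedPow_nonneg_of_tendsto {q C : ℝ} (hq : 1 ≤ q) {f : ℕ → α → ℝ} {F : α → ℝ}
    (hf : ∀ n, AEMeasurable (f n) μ) (hC : ∀ n, ∀ᵐ x ∂μ, |f n x| ≤ C)
    (hle : ∀ᵐ x ∂μ, ∀ n, F x ≤ f n x)
    (hlim : ∀ᵐ x ∂μ, Tendsto (fun n => f n x) atTop (𝓝 (F x)))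
    (h0 : ∀ n, 0 ≤ ∫ x, signedPow q (f n x) ∂μ) : 0 ≤ ∫ x, signedPow q (F x) ∂μ := by
  refine ge_of_tendsto' (tendsto_integral_of_dominated_convergence (fun _ => C ^ (q - 1))
    (F := fun n x => signedPow q (f n x)) (f := fun x => signedPow q (F x)) ?_
    (integrable_const _) ?_ ?_) h0
  · intro n
    exact ((signedPow_mono hq).measurable.comp_aemeasurable (hf n)).aestronglyMeasurable
  · intro n
    filter_upwards [hC n] with x hx
    exact abs_signedPow_le hq hx
  · filter_upwards [hle, hlim] with x h1 h2
    exact tendsto_signedPow hq h2 h1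

lemma integrable_abs_rpow {q C : ℝ} (hq : 1 ≤ q) {f : α → ℝ} (hf : AEMeasurable f μ)
    (hC : ∀ᵐ x ∂μ, |f x| ≤ C) (t : ℝ) : Integrable (fun x => |f x - t| ^ q) μ := by
  refine Integrable.mono' (integrable_const ((C + |t|) ^ q)) ?_ ?_
  · exact (((hf.sub_const t).norm).pow_const q).aestronglyMeasurable
  · filter_upwards [hC] with x hx
    rw [Real.norm_eq_abs, abs_of_nonneg (by positivity)]
    exact Real.rpow_le_rpow (abs_nonneg _) ((abs_sub _ _).trans (by linarith)) (by linarith)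

lemma integral_abs_rpow_tangent {q C : ℝ} (hq : 1 ≤ q) {f : α → ℝ} (hf : AEMeasurable f μ)
    (hC : ∀ᵐ x ∂μ, |f x| ≤ C) (s t : ℝ) :
    ∫ x, |f x - t| ^ q ∂μ + q * (∫ x, signedPow q (f x - t) ∂μ) * (t - s)
      ≤ ∫ x, |f x - s| ^ q ∂μ := by
  have h1 := integrable_abs_rpow hq hf hC t
  have h2 := integrable_signedPow hq hf hC t
  rw [mul_comm q, mul_assoc, ← integral_mul_const, ← integral_add h1 (h2.mul_const _)]
  refine integral_mono (h1.add (h2.mul_const _)) (integrable_abs_rpow hq hf hC s) fun x => ?_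
  have := abs_rpow_add_mul_le hq (f x - s) (f x - t)
  simp only
  linarith [this]

end Integral

section FiniteExponent

variable {α : Type*} [MeasurableSpace α] {μ : Measure α} [IsFiniteMeasure μ]

omit [IsFiniteMeasure μ] in
lemma integral_pos_of_ae_pos {f : α → ℝ} (hμ : μ ≠ 0) (hf : Integrable f μ)
    (h : ∀ᵐ x ∂μ, 0 < f x) : 0 < ∫ x, f x ∂μ := by
  rw [integral_pos_iff_support_of_nonneg_ae (h.mono fun x hx => hx.le) hf]
  rw [pos_iff_ne_zero]
  intro h0
  have h1 : ∀ᵐ x ∂μ, x ∉ Function.support f := measure_eq_zero_iff_ae_notMem.1 h0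
  have h2 : ∀ᵐ x ∂μ, False := by
    filter_upwards [h, h1] with x hx hx'
    exact hx' hx.ne'
  exact hμ (ae_eq_bot.1 (eventually_false_iff_eq_bot.1 h2))

lemma integral_signedPow_lt_of_gap {q C : ℝ} (hq : 1 ≤ q) (hμ : μ ≠ 0) {f : α → ℝ}
    (hf : AEMeasurable f μ) (hC : ∀ᵐ x ∂μ, |f x| ≤ C) {s t : ℝ} (hst : s < t)
    (hgap : (∀ᵐ x ∂μ, t ≤ f x) ∨ (∀ᵐ x ∂μ, f x ≤ s) ∨ μ {x | s < f x ∧ f x < t} ≠ 0)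
    (h0 : 0 ≤ ∫ x, signedPow q (f x - t) ∂μ) : 0 < ∫ x, signedPow q (f x - s) ∂μ := by
  rcases hgap with h | h | h
  · refine integral_pos_of_ae_pos hμ (integrable_signedPow hq hf hC s) ?_
    filter_upwards [h] with x hx
    exact signedPow_pos (by linarith)
  · exfalso
    have : 0 < ∫ x, -signedPow q (f x - t) ∂μ := by
      refine integral_pos_of_ae_pos hμ (integrable_signedPow hq hf hC t).neg ?_
      filter_upwards [h] with x hx
      have := signedPow_neg_of_neg (q := q) (show f x - t < 0 by linarith)
      linarith
    rw [integral_neg] at this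
    linarith
  · refine lt_of_le_of_lt h0 ?_
    rw [← sub_pos, ← integral_sub (integrable_signedPow hq hf hC s)
      (integrable_signedPow hq hf hC t)]
    rw [integral_pos_iff_support_of_nonneg]
    · refine lt_of_lt_of_le (pos_iff_ne_zero.2 h) (measure_mono ?_)
      rintro x ⟨h1, h2⟩
      have e1 := signedPow_pos (q := q) (show 0 < f x - s by linarith)
      have e2 := signedPow_neg_of_neg (q := q) (show f x - t < 0 by linarith)
      rw [Function.mem_support]
      linarith
    · intro x
      have := signedPow_mono hq (show f x - t ≤ f x - s by linarith)
      simp only [Pi.zero_apply]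
      linarith
    · exact (integrable_signedPow hq hf hC s).sub (integrable_signedPow hq hf hC t)

lemma exists_signedPow_threshold {q C : ℝ} (hq : 1 ≤ q) (hμ : μ ≠ 0) {f : α → ℝ}
    (hf : AEMeasurable f μ) (hC : ∀ᵐ x ∂μ, |f x| ≤ C) :
    ∃ m : ℝ, ∀ t, t ≤ m ↔ 0 ≤ ∫ x, signedPow q (f x - t) ∂μ := by
  set J : ℝ → ℝ := fun t => ∫ x, signedPow q (f x - t) ∂μ with hJ
  have hanti : Antitone J := fun s t hst =>
    integral_signedPow_mono hq hf hC hf hC (Eventually.of_forall fun _ => le_rfl) hst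
  have hne : {t | 0 ≤ J t}.Nonempty := by
    refine ⟨-C, show 0 ≤ J (-C) from integral_nonneg_of_ae ?_⟩
    filter_upwards [hC] with x hx
    have h1 := neg_le_of_abs_le hx
    simp only [Pi.zero_apply]
    rw [signedPow_of_nonneg (by linarith)]
    exact Real.rpow_nonneg (by linarith) _
  have hbdd : BddAbove {t | 0 ≤ J t} := by
    refine ⟨C + 1, fun t ht => ?_⟩
    by_contra! hlt
    have : 0 < ∫ x, -signedPow q (f x - t) ∂μ := by
      refine integral_pos_of_ae_pos hμ (integrable_signedPow hq hf hC t).neg ?_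
      filter_upwards [hC] with x hx
      have := signedPow_neg_of_neg (q := q) (show f x - t < 0 by linarith [le_of_abs_le hx])
      linarith
    rw [integral_neg] at this
    have : 0 ≤ J t := ht
    simp only [hJ] at this
    linarith
  refine ⟨sSup {t | 0 ≤ J t}, fun t => ⟨fun ht => ?_, fun ht => le_csSup hbdd ht⟩⟩
  refine le_trans ?_ (hanti ht)
  set m := sSup {t | 0 ≤ J t}
  have hlt : ∀ s < m, 0 ≤ J s := fun s hs => by
    obtain ⟨r, hr, hsr⟩ := exists_lt_of_lt_csSup hne hs
    exact le_trans hr (hanti hsr.le)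
  have hlim : Tendsto (fun n : ℕ => m - 1 / ((n : ℝ) + 1)) atTop (𝓝 m) := by
    simpa using (tendsto_const_nhds (x := m)).sub
      (tendsto_one_div_add_atTop_nhds_zero_nat (𝕜 := ℝ))
  refine integral_signedPow_nonneg_of_tendsto (C := C + |m| + 1) hq
    (f := fun n x => f x - (m - 1 / ((n : ℝ) + 1))) ?_ ?_ ?_ ?_ ?_
  · exact fun n => hf.sub_const _
  · intro n
    filter_upwards [hC] with x hx
    have h1 : 0 < 1 / ((n : ℝ) + 1) := by positivity
    have h2 : 1 / ((n : ℝ) + 1) ≤ 1 := by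
      rw [div_le_one (by positivity)]; linarith [Nat.cast_nonneg (α := ℝ) n]
    rw [abs_le] at hx ⊢
    constructor <;> linarith [le_abs_self m, neg_abs_le m]
  · refine Eventually.of_forall fun x n => ?_
    have h1 : 0 < 1 / ((n : ℝ) + 1) := by positivity
    linarith
  · exact Eventually.of_forall fun x => tendsto_const_nhds.sub hlim
  · intro n
    have h1 : 0 < 1 / ((n : ℝ) + 1) := by positivity
    exact hlt _ (by linarith)

lemma integral_abs_rpow_lt_of_ne {q C : ℝ} (hq : 1 ≤ q) (hμ : μ ≠ 0) {f : α → ℝ}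
    (hf : AEMeasurable f μ) (hC : ∀ᵐ x ∂μ, |f x| ≤ C)
    (hgap : ∀ s t, s < t →
      (∀ᵐ x ∂μ, t ≤ f x) ∨ (∀ᵐ x ∂μ, f x ≤ s) ∨ μ {x | s < f x ∧ f x < t} ≠ 0)
    {m : ℝ} (hm : ∀ t, t ≤ m ↔ 0 ≤ ∫ x, signedPow q (f x - t) ∂μ) {s : ℝ} (hs : s ≠ m) :
    ∫ x, |f x - m| ^ q ∂μ < ∫ x, |f x - s| ^ q ∂μ := by
  have tangent := integral_abs_rpow_tangent hq hf hC
  have hJm := (hm m).1 le_rfl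
  rcases lt_or_gt_of_ne hs with h | h
  · obtain ⟨t, hst, htm⟩ := exists_between h
    have hJt := integral_signedPow_lt_of_gap hq hμ hf hC htm (hgap t m htm) hJm
    have h1 := tangent s t
    have h2 := tangent t m
    have h3 : 0 < q * (∫ x, signedPow q (f x - t) ∂μ) * (t - s) :=
      mul_pos (mul_pos (by linarith) hJt) (by linarith)
    have h4 : 0 ≤ q * (∫ x, signedPow q (f x - m) ∂μ) * (m - t) :=
      mul_nonneg (mul_nonneg (by linarith) hJm) (by linarith)
    linarith
  · obtain ⟨t, hmt, hts⟩ := exists_between h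
    have hneg : ∀ r, m < r → ∫ x, signedPow q (f x - r) ∂μ < 0 := fun r hr => by
      by_contra! h0
      exact absurd ((hm r).2 h0) (not_le.2 hr)
    have h1 := tangent s t
    have h3 : 0 < q * (∫ x, signedPow q (f x - t) ∂μ) * (t - s) :=
      mul_pos_of_neg_of_neg (mul_neg_of_pos_of_neg (by linarith) (hneg t hmt)) (by linarith)
    suffices ∫ x, |f x - m| ^ q ∂μ ≤ ∫ x, |f x - t| ^ q ∂μ by linarith
    have hlim : Tendsto (fun r : ℝ => ∫ x, |f x - m| ^ q ∂μ
        + q * (∫ x, signedPow q (f x - m) ∂μ) * (m - r)) (𝓝[>] m)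
        (𝓝 (∫ x, |f x - m| ^ q ∂μ + q * (∫ x, signedPow q (f x - m) ∂μ) * (m - m))) := by
      refine Tendsto.mono_left ?_ nhdsWithin_le_nhds
      exact Continuous.tendsto (by fun_prop) m
    rw [sub_self, mul_zero, add_zero] at hlim
    refine le_of_tendsto hlim ?_
    filter_upwards [Ioo_mem_nhdsGT hmt] with r hr
    have h5 := tangent r m
    have h6 := tangent t r
    have h7 : 0 ≤ q * (∫ x, signedPow q (f x - r) ∂μ) * (r - t) :=
      (mul_pos_of_neg_of_neg (mul_neg_of_pos_of_neg (by linarith) (hneg r hr.1))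
        (by linarith [hr.2])).le
    linarith

lemma memLp_sub_const_of_bounded {C : ℝ} {p : ℝ≥0∞} {f : α → ℝ} (hf : AEMeasurable f μ)
    (hC : ∀ᵐ x ∂μ, |f x| ≤ C) (m : ℝ) : MemLp (fun x => f x - m) p μ := by
  refine MemLp.of_bound (hf.sub_const m).aestronglyMeasurable (C + |m|) ?_
  filter_upwards [hC] with x hx
  exact (abs_sub _ _).trans (by linarith)

lemma eLpNorm_sub_const_le_iff {p : ℝ≥0∞} (hp : 1 ≤ p) (hp' : p ≠ ⊤) {C : ℝ} {f : α → ℝ}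
    (hf : AEMeasurable f μ) (hC : ∀ᵐ x ∂μ, |f x| ≤ C) (m s : ℝ) :
    eLpNorm (fun x => f x - m) p μ ≤ eLpNorm (fun x => f x - s) p μ ↔
      ∫ x, |f x - m| ^ p.toReal ∂μ ≤ ∫ x, |f x - s| ^ p.toReal ∂μ := by
  have hp0 : p ≠ 0 := (zero_lt_one.trans_le hp).ne'
  have hq : 0 < p.toReal := ENNReal.toReal_pos hp0 hp'
  rw [MemLp.eLpNorm_eq_integral_rpow_norm hp0 hp' (memLp_sub_const_of_bounded hf hC m),
    MemLp.eLpNorm_eq_integral_rpow_norm hp0 hp' (memLp_sub_const_of_bounded hf hC s)]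
  simp only [Real.norm_eq_abs]
  have h0 : ∀ t, 0 ≤ ∫ x, |f x - t| ^ p.toReal ∂μ := fun t => integral_nonneg fun x => by positivity
  rw [ENNReal.ofReal_le_ofReal_iff (Real.rpow_nonneg (h0 s) _),
    Real.rpow_le_rpow_iff (h0 m) (h0 s) (inv_pos.2 hq)]

end FiniteExponent

/-- Existence, uniqueness and characterization of the `p`-mean for finite `p`. -/
lemma exists_isPMean_iff_of_ne_top {N : ℕ} {p : ℝ≥0∞} (hp : 1 ≤ p) (hp' : p ≠ ⊤)
    {μ : Measure (EuclideanSpace ℝ (Fin N))} [IsFiniteMeasure μ] (hμ : μ ≠ 0) {C : ℝ}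
    {f : EuclideanSpace ℝ (Fin N) → ℝ} (hf : AEMeasurable f μ) (hC : ∀ᵐ x ∂μ, |f x| ≤ C)
    (hgap : ∀ s t, s < t →
      (∀ᵐ x ∂μ, t ≤ f x) ∨ (∀ᵐ x ∂μ, f x ≤ s) ∨ μ {x | s < f x ∧ f x < t} ≠ 0) :
    ∃ m, (∀ m', IsPMean p μ f m' ↔ m' = m) ∧
      ∀ t, t ≤ m ↔ 0 ≤ ∫ x, signedPow p.toReal (f x - t) ∂μ := by
  have hq : 1 ≤ p.toReal := by
    rw [← ENNReal.toReal_one]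
    exact ENNReal.toReal_mono hp' hp
  obtain ⟨m, hm⟩ := exists_signedPow_threshold hq hμ hf hC
  have hlt : ∀ s, s ≠ m → _ := fun s hs => integral_abs_rpow_lt_of_ne hq hμ hf hC hgap hm hs
  refine ⟨m, fun m' => ⟨fun h => ?_, ?_⟩, hm⟩
  · by_contra hne
    have h1 := (eLpNorm_sub_const_le_iff hp hp' hf hC m' m).1 (h m)
    exact absurd (hlt m' hne) (not_lt.2 h1)
  · rintro rfl s
    rw [eLpNorm_sub_const_le_iff hp hp' hf hC]
    rcases eq_or_ne s m' with rfl | hs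
    · exact le_rfl
    · exact (hlt s hs).le

section Ball

variable {N : ℕ} {x : EuclideanSpace ℝ (Fin N)} {r : ℝ}

lemma restrict_ball_ne_zero (hr : 0 < r) : volume.restrict (ball x r) ≠ 0 := by
  rw [Ne, Measure.restrict_eq_zero]
  exact (measure_ball_pos volume x hr).ne'

instance isFiniteMeasure_restrict_ball : IsFiniteMeasure (volume.restrict (ball x r)) :=
  ⟨by rw [Measure.restrict_apply_univ]; exact measure_ball_lt_top⟩

lemma aemeasurable_restrict_ball {f : EuclideanSpace ℝ (Fin N) → ℝ}
    (hf : ContinuousOn f (closedBall x r)) : AEMeasurable f (volume.restrict (ball x r)) :=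
  (hf.mono ball_subset_closedBall).aemeasurable measurableSet_ball

lemma exists_abs_le_of_continuousOn_closedBall {f : EuclideanSpace ℝ (Fin N) → ℝ}
    (hf : ContinuousOn f (closedBall x r)) : ∃ C, ∀ y ∈ closedBall x r, |f y| ≤ C :=
  (isCompact_closedBall x r).exists_bound_of_continuousOn hf

lemma ae_restrict_ball_of_forall {P : EuclideanSpace ℝ (Fin N) → Prop}
    (h : ∀ y ∈ ball x r, P y) : ∀ᵐ y ∂volume.restrict (ball x r), P y :=
  (ae_restrict_iff' measurableSet_ball).2 (Eventually.of_forall h)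

lemma forall_closedBall_le_of_ae {f : EuclideanSpace ℝ (Fin N) → ℝ} (hr : 0 < r)
    (hf : ContinuousOn f (closedBall x r)) {c : ℝ}
    (h : ∀ᵐ y ∂volume.restrict (ball x r), f y ≤ c) : ∀ y ∈ closedBall x r, f y ≤ c := by
  have hb : ∀ y ∈ ball x r, f y ≤ c := by
    have hopen : IsOpen (ball x r ∩ f ⁻¹' Set.Ioi c) :=
      (hf.mono ball_subset_closedBall).isOpen_inter_preimage isOpen_ball isOpen_Ioi
    have hnull : volume (ball x r ∩ f ⁻¹' Set.Ioi c) = 0 := by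
      rw [ae_restrict_iff' measurableSet_ball] at h
      refine measure_mono_null ?_ h
      rintro y ⟨hy, hy'⟩ hc
      exact absurd (hc hy) (not_le.2 hy')
    rw [hopen.measure_eq_zero_iff volume] at hnull
    intro y hy
    by_contra! hlt
    exact (Set.eq_empty_iff_forall_notMem.1 hnull y) ⟨hy, hlt⟩
  intro y hy
  rw [← closure_ball x hr.ne'] at hy hf
  exact ContinuousWithinAt.closure_le hy ((hf y hy).mono subset_closure)
    continuousWithinAt_const hb

lemma ae_le_or_ae_le_or_measure_ne_zero {f : EuclideanSpace ℝ (Fin N) → ℝ}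
    (hf : ContinuousOn f (closedBall x r)) (s t : ℝ) (hst : s < t) :
    (∀ᵐ y ∂volume.restrict (ball x r), t ≤ f y) ∨ (∀ᵐ y ∂volume.restrict (ball x r), f y ≤ s) ∨
      volume.restrict (ball x r) {y | s < f y ∧ f y < t} ≠ 0 := by
  have hfb := hf.mono ball_subset_closedBall
  by_cases h1 : ∀ y ∈ ball x r, t ≤ f y
  · exact Or.inl (ae_restrict_ball_of_forall h1)
  by_cases h2 : ∀ y ∈ ball x r, f y ≤ s
  · exact Or.inr (Or.inl (ae_restrict_ball_of_forall h2))
  refine Or.inr (Or.inr ?_)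
  push Not at h1 h2
  obtain ⟨a, ha, hat⟩ := h1
  obtain ⟨b, hb, hbs⟩ := h2
  obtain ⟨y, hy, hys, hyt⟩ : ∃ y ∈ ball x r, s < f y ∧ f y < t := by
    rcases lt_or_ge s (f a) with h | h
    · exact ⟨a, ha, h, hat⟩
    rcases lt_or_ge (f b) t with h' | h'
    · exact ⟨b, hb, hbs, h'⟩
    obtain ⟨y, hy, hfy⟩ := (convex_ball x r).isPreconnected.intermediate_value ha hb hfb
      (show (s + t) / 2 ∈ Set.Icc (f a) (f b) from ⟨by linarith, by linarith⟩)
    exact ⟨y, hy, by linarith, by linarith⟩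
  have hopen : IsOpen (ball x r ∩ f ⁻¹' Set.Ioo s t) :=
    hfb.isOpen_inter_preimage isOpen_ball isOpen_Ioo
  have hpos := hopen.measure_pos volume ⟨y, hy, hys, hyt⟩
  rw [Measure.restrict_apply' measurableSet_ball, Set.inter_comm]
  exact hpos.ne'

lemma pMean_threshold_of_ne_top {p : ℝ≥0∞} (hp : 1 ≤ p) (hp' : p ≠ ⊤) (hr : 0 < r)
    {f : EuclideanSpace ℝ (Fin N) → ℝ} (hf : ContinuousOn f (closedBall x r)) :
    ∃ m, (∀ m', IsPMean p (volume.restrict (ball x r)) f m' ↔ m' = m) ∧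
      ∀ t, t ≤ m ↔ 0 ≤ ∫ y in ball x r, signedPow p.toReal (f y - t) := by
  obtain ⟨C, hC⟩ := exists_abs_le_of_continuousOn_closedBall hf
  exact exists_isPMean_iff_of_ne_top hp hp' (restrict_ball_ne_zero hr)
    (aemeasurable_restrict_ball hf)
    (ae_restrict_ball_of_forall fun y hy => hC y (ball_subset_closedBall hy))
    (ae_le_or_ae_le_or_measure_ne_zero hf)

lemma pMean_threshold_top (hr : 0 < r) {f : EuclideanSpace ℝ (Fin N) → ℝ}
    (hf : ContinuousOn f (closedBall x r)) :
    ∃ m, (∀ m', IsPMean ⊤ (volume.restrict (ball x r)) f m' ↔ m' = m) ∧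
      ∃ a ∈ closedBall x r, ∃ b ∈ closedBall x r,
        (∀ y ∈ closedBall x r, f b ≤ f y ∧ f y ≤ f a) ∧ m = (f a + f b) / 2 := by
  have hne : (closedBall x r).Nonempty := ⟨x, mem_closedBall_self hr.le⟩
  obtain ⟨a, ha, hmax⟩ := (isCompact_closedBall x r).exists_isMaxOn hne hf
  obtain ⟨b, hb, hmin⟩ := (isCompact_closedBall x r).exists_isMinOn hne hf
  have hab : ∀ y ∈ closedBall x r, f b ≤ f y ∧ f y ≤ f a := fun y hy => ⟨hmin hy, hmax hy⟩
  set μ := volume.restrict (ball x r) with hμ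
  have lower : ∀ ν c : ℝ, 0 ≤ c → eLpNorm (fun y => f y - ν) ⊤ μ ≤ ENNReal.ofReal c →
      |f a - ν| ≤ c ∧ |f b - ν| ≤ c := by
    intro ν c hc h
    have h1 : ∀ᵐ y ∂μ, |f y - ν| ≤ c := by
      rw [eLpNorm_exponent_top] at h
      filter_upwards [enorm_ae_le_eLpNormEssSup (fun y => f y - ν) μ] with y hy
      have := hy.trans h
      rwa [← ofReal_norm, ENNReal.ofReal_le_ofReal_iff hc] at this
    have h2 := forall_closedBall_le_of_ae hr (hf.sub continuousOn_const).abs h1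
    exact ⟨h2 a ha, h2 b hb⟩
  have hba : f b ≤ f a := (hab a ha).1
  have upper : eLpNorm (fun y => f y - (f a + f b) / 2) ⊤ μ
      ≤ ENNReal.ofReal ((f a - f b) / 2) := by
    rw [eLpNorm_exponent_top]
    refine eLpNormEssSup_le_of_ae_bound (ae_restrict_ball_of_forall fun y hy => ?_)
    have := hab y (ball_subset_closedBall hy)
    rw [Real.norm_eq_abs, abs_le]
    constructor <;> linarith
  refine ⟨(f a + f b) / 2, fun m' => ⟨fun h => ?_, ?_⟩, a, ha, b, hb, hab, rfl⟩
  · obtain ⟨h1, h2⟩ := lower m' _ (by linarith) ((h _).trans upper)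
    rw [abs_le] at h1 h2
    linarith
  · rintro rfl ν
    refine upper.trans ?_
    have hfin : eLpNorm (fun y => f y - ν) ⊤ μ ≠ ⊤ := by
      obtain ⟨C, hC⟩ := exists_abs_le_of_continuousOn_closedBall hf
      exact (memLp_sub_const_of_bounded (aemeasurable_restrict_ball hf)
        (ae_restrict_ball_of_forall fun y hy => hC y (ball_subset_closedBall hy)) ν).2.ne
    rw [← ENNReal.ofReal_toReal hfin]
    refine ENNReal.ofReal_le_ofReal ?_
    obtain ⟨h1, h2⟩ := lower ν _ ENNReal.toReal_nonneg (ENNReal.ofReal_toReal hfin).ge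
    linarith [le_of_abs_le h1, neg_le_of_abs_le h2]

lemma isPMean_iff_eq_pMean {p : ℝ≥0∞} (hp : 1 ≤ p) (hr : 0 < r)
    {f : EuclideanSpace ℝ (Fin N) → ℝ} (hf : ContinuousOn f (closedBall x r)) (m : ℝ) :
    IsPMean p (volume.restrict (ball x r)) f m ↔
      m = pMean p (volume.restrict (ball x r)) f := by
  obtain ⟨m₀, hm₀⟩ : ∃ m₀, ∀ m', IsPMean p (volume.restrict (ball x r)) f m' ↔ m' = m₀ := by
    rcases eq_or_ne p ⊤ with rfl | hp'
    · obtain ⟨m₀, h, -⟩ := pMean_threshold_top hr hf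
      exact ⟨m₀, h⟩
    · obtain ⟨m₀, h, -⟩ := pMean_threshold_of_ne_top hp hp' hr hf
      exact ⟨m₀, h⟩
  have : pMean p (volume.restrict (ball x r)) f = m₀ :=
    (hm₀ _).1 (Classical.epsilon_spec ⟨m₀, (hm₀ m₀).2 rfl⟩)
  rw [hm₀, this]

lemma le_pMean_iff {p : ℝ≥0∞} (hp : 1 ≤ p) (hp' : p ≠ ⊤) (hr : 0 < r)
    {f : EuclideanSpace ℝ (Fin N) → ℝ} (hf : ContinuousOn f (closedBall x r)) (t : ℝ) :
    t ≤ pMean p (volume.restrict (ball x r)) f ↔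
      0 ≤ ∫ y in ball x r, signedPow p.toReal (f y - t) := by
  obtain ⟨m₀, h, h'⟩ := pMean_threshold_of_ne_top hp hp' hr hf
  rw [← h', (h _).1 ((isPMean_iff_eq_pMean hp hr hf _).2 rfl)]

lemma exists_pMean_top_eq (hr : 0 < r) {f : EuclideanSpace ℝ (Fin N) → ℝ}
    (hf : ContinuousOn f (closedBall x r)) :
    ∃ a ∈ closedBall x r, ∃ b ∈ closedBall x r,
      (∀ y ∈ closedBall x r, f b ≤ f y ∧ f y ≤ f a) ∧
        pMean ⊤ (volume.restrict (ball x r)) f = (f a + f b) / 2 := by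
  obtain ⟨m₀, h, h'⟩ := pMean_threshold_top hr hf
  rwa [(h _).1 ((isPMean_iff_eq_pMean le_top hr hf _).2 rfl)]

lemma one_le_toReal {p : ℝ≥0∞} (hp : 1 ≤ p) (hp' : p ≠ ⊤) : 1 ≤ p.toReal := by
  rw [← ENNReal.toReal_one]
  exact ENNReal.toReal_mono hp' hp

lemma pMean_mono {p : ℝ≥0∞} (hp : 1 ≤ p) (hr : 0 < r) {f h : EuclideanSpace ℝ (Fin N) → ℝ}
    (hf : ContinuousOn f (closedBall x r)) (hh : ContinuousOn h (closedBall x r))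
    (hfh : ∀ y ∈ closedBall x r, f y ≤ h y) :
    pMean p (volume.restrict (ball x r)) f ≤ pMean p (volume.restrict (ball x r)) h := by
  rcases eq_or_ne p ⊤ with rfl | hp'
  · obtain ⟨a, ha, b, hb, hab, e⟩ := exists_pMean_top_eq hr hf
    obtain ⟨a', ha', b', hb', hab', e'⟩ := exists_pMean_top_eq hr hh
    rw [e, e']
    linarith [hfh a ha, hfh b' hb', (hab' a ha).2, (hab b' hb').1]
  · obtain ⟨C, hC⟩ := exists_abs_le_of_continuousOn_closedBall hf
    obtain ⟨C', hC'⟩ := exists_abs_le_of_continuousOn_closedBall hh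
    rw [le_pMean_iff hp hp' hr hh]
    refine ((le_pMean_iff hp hp' hr hf _).1 le_rfl).trans ?_
    refine integral_signedPow_mono (C := max C C') (one_le_toReal hp hp')
      (aemeasurable_restrict_ball hf) (ae_restrict_ball_of_forall fun y hy => ?_)
      (aemeasurable_restrict_ball hh) (ae_restrict_ball_of_forall fun y hy => ?_)
      (ae_restrict_ball_of_forall fun y hy => hfh y (ball_subset_closedBall hy)) le_rfl
    · exact (hC y (ball_subset_closedBall hy)).trans (le_max_left _ _)
    · exact (hC' y (ball_subset_closedBall hy)).trans (le_max_right _ _)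

lemma pMean_const {p : ℝ≥0∞} (hp : 1 ≤ p) (hr : 0 < r) (c : ℝ) :
    pMean p (volume.restrict (ball x r)) (fun _ => c) = c := by
  symm
  rw [← isPMean_iff_eq_pMean hp hr continuousOn_const]
  intro ν
  simp only [sub_self]
  simp

lemma pMean_mul_add {p : ℝ≥0∞} (hp : 1 ≤ p) (hr : 0 < r) {f : EuclideanSpace ℝ (Fin N) → ℝ}
    (hf : ContinuousOn f (closedBall x r)) (a c : ℝ) :
    pMean p (volume.restrict (ball x r)) (fun y => a * f y + c) =
      a * pMean p (volume.restrict (ball x r)) f + c := by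
  rcases eq_or_ne a 0 with rfl | ha
  · simpa using pMean_const hp hr c
  have hcont : ContinuousOn (fun y => a * f y + c) (closedBall x r) :=
    (continuousOn_const.mul hf).add continuousOn_const
  symm
  rw [← isPMean_iff_eq_pMean hp hr hcont]
  intro ν
  set m := pMean p (volume.restrict (ball x r)) f
  have hm : IsPMean p (volume.restrict (ball x r)) f m := (isPMean_iff_eq_pMean hp hr hf m).2 rfl
  have e1 : (fun y => a * f y + c - (a * m + c)) = a • fun y => f y - m := by
    ext y; simp only [Pi.smul_apply, smul_eq_mul]; ring
  have e2 : (fun y => a * f y + c - ν) = a • fun y => f y - (ν - c) / a := by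
    ext y; simp only [Pi.smul_apply, smul_eq_mul]; field_simp; ring
  rw [e1, e2, eLpNorm_const_smul, eLpNorm_const_smul]
  gcongr
  exact hm _

lemma pMean_congr {p : ℝ≥0∞} {f h : EuclideanSpace ℝ (Fin N) → ℝ}
    (hfh : ∀ y ∈ ball x r, f y = h y) :
    pMean p (volume.restrict (ball x r)) f = pMean p (volume.restrict (ball x r)) h := by
  have : IsPMean p (volume.restrict (ball x r)) f = IsPMean p (volume.restrict (ball x r)) h := by
    ext m
    have e : ∀ ν, eLpNorm (fun y => f y - ν) p (volume.restrict (ball x r)) =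
        eLpNorm (fun y => h y - ν) p (volume.restrict (ball x r)) := fun ν =>
      eLpNorm_congr_ae (ae_restrict_ball_of_forall fun y hy => by simp only [hfh y hy])
    simp only [IsPMean, e]
  rw [pMean, pMean, this]

lemma abs_pMean_sub_le {p : ℝ≥0∞} (hp : 1 ≤ p) (hr : 0 < r)
    {f h : EuclideanSpace ℝ (Fin N) → ℝ}
    (hf : ContinuousOn f (closedBall x r)) (hh : ContinuousOn h (closedBall x r)) {η : ℝ}
    (hfh : ∀ y ∈ closedBall x r, |f y - h y| ≤ η) :
    |pMean p (volume.restrict (ball x r)) f - pMean p (volume.restrict (ball x r)) h| ≤ η := by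
  have key : ∀ f h : EuclideanSpace ℝ (Fin N) → ℝ, ContinuousOn f (closedBall x r) →
      ContinuousOn h (closedBall x r) → (∀ y ∈ closedBall x r, |f y - h y| ≤ η) →
      pMean p (volume.restrict (ball x r)) f ≤ pMean p (volume.restrict (ball x r)) h + η := by
    intro f h hf hh hfh
    have := pMean_mul_add hp hr hh 1 η
    simp only [one_mul] at this
    rw [← this]
    refine pMean_mono hp hr hf (hh.add continuousOn_const) fun y hy => ?_
    linarith [le_of_abs_le (hfh y hy)]
  rw [abs_sub_le_iff]
  constructor
  · linarith [key f h hf hh hfh]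
  · linarith [key h f hh hf fun y hy => by rw [abs_sub_comm]; exact hfh y hy]

/-- The `p`-mean is invariant under a change of ball by translation and dilation. -/
lemma pMean_rescale {p : ℝ≥0∞} (hr : 0 < r) {x' : EuclideanSpace ℝ (Fin N)} {r' : ℝ}
    (hr' : 0 < r') (f : EuclideanSpace ℝ (Fin N) → ℝ) :
    pMean p (volume.restrict (ball x' r')) f =
      pMean p (volume.restrict (ball x r)) (fun y => f (x' + (r' / r) • (y - x))) := by
  set k := r' / r
  have hk : 0 < k := div_pos hr' hr
  set T : EuclideanSpace ℝ (Fin N) ≃ₜ EuclideanSpace ℝ (Fin N) :=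
    ((Homeomorph.addRight (-x)).trans (Homeomorph.smulOfNeZero k hk.ne')).trans
      (Homeomorph.addLeft x') with hT
  have hTy : ∀ y, T y = x' + k • (y - x) := fun y => by simp [hT, sub_eq_add_neg]
  have hpre : T ⁻¹' ball x' r' = ball x r := by
    ext y
    rw [Set.mem_preimage, hTy, mem_ball, mem_ball, dist_eq_norm, dist_eq_norm, add_sub_cancel_left,
      norm_smul, Real.norm_eq_abs, abs_of_pos hk, div_mul_eq_mul_div, div_lt_iff₀ hr,
      mul_lt_mul_iff_right₀ hr']
  have hmap : ∃ c : ℝ≥0∞, c ≠ 0 ∧ c ≠ ⊤ ∧ Measure.map T volume = c • volume := by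
    refine ⟨ENNReal.ofReal |(k ^ Module.finrank ℝ (EuclideanSpace ℝ (Fin N)))⁻¹|, ?_,
      ENNReal.ofReal_ne_top, ?_⟩
    · rw [Ne, ENNReal.ofReal_eq_zero, not_le]
      positivity
    · have e1 : (T : EuclideanSpace ℝ (Fin N) → EuclideanSpace ℝ (Fin N)) =
          (fun y => x' + y) ∘ (fun y => k • y) ∘ (fun y => y + -x) := by
        ext1 y; simp [hTy, sub_eq_add_neg]
      rw [e1, ← Measure.map_map (by fun_prop) (by fun_prop),
        ← Measure.map_map (by fun_prop) (by fun_prop), map_add_right_eq_self,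
        Measure.map_addHaar_smul _ hk.ne', Measure.map_smul, map_add_left_eq_self]
  obtain ⟨c, hc0, hct, hc⟩ := hmap
  have hemb : MeasurableEmbedding T := T.measurableEmbedding
  have hrestr : Measure.map T (volume.restrict (ball x r)) = c • volume.restrict (ball x' r') := by
    rw [← hpre, ← hemb.restrict_map, hc, Measure.restrict_smul]
  have hnorm : ∀ ν, eLpNorm (fun y => f (x' + k • (y - x)) - ν) p (volume.restrict (ball x r)) =
      c ^ (1 / p).toReal * eLpNorm (fun y => f y - ν) p (volume.restrict (ball x' r')) := by
    intro ν
    rw [← smul_eq_mul, ← eLpNorm_smul_measure_of_ne_zero hc0, ← hrestr,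
      hemb.eLpNorm_map_measure]
    congr 1
  have : IsPMean p (volume.restrict (ball x' r')) f =
      IsPMean p (volume.restrict (ball x r)) (fun y => f (x' + k • (y - x))) := by
    ext m
    simp only [IsPMean, hnorm]
    refine forall_congr' fun ν => ?_
    have hcr0 : c ^ (1 / p).toReal ≠ 0 := (ENNReal.rpow_pos (pos_iff_ne_zero.2 hc0) hct).ne'
    have hcrt : c ^ (1 / p).toReal ≠ ⊤ := ENNReal.rpow_ne_top_of_nonneg ENNReal.toReal_nonneg hct
    rw [ENNReal.mul_le_mul_iff_right hcr0 hcrt]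
  rw [pMean, pMean, this]

end Ball

/-- The standing assumptions on the domain and on the scale `ε`. -/
structure AdmissibleDomain {N : ℕ} (Ω : Set (EuclideanSpace ℝ (Fin N))) (ε : ℝ) : Prop where
  dim_pos : 0 < N
  isOpen : IsOpen Ω
  isBounded : Bornology.IsBounded Ω
  nonempty : Ω.Nonempty
  eps_pos : 0 < ε

lemma isCompact_isOpen_eq_empty {N : ℕ} (hN : 0 < N) {K : Set (EuclideanSpace ℝ (Fin N))}
    (hK : IsCompact K) (hK' : IsOpen K) : K = ∅ := by
  have : Nonempty (Fin N) := ⟨⟨0, hN⟩⟩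
  have : NoncompactSpace (EuclideanSpace ℝ (Fin N)) := by
    have : Nontrivial (EuclideanSpace ℝ (Fin N)) := inferInstance
    exact NormedSpace.noncompactSpace ℝ _
  rcases isClopen_iff.1 ⟨hK.isClosed, hK'⟩ with h | h
  · exact h
  · exact absurd (h ▸ hK) (noncompact_univ _)

namespace AdmissibleDomain

variable {N : ℕ} {Ω : Set (EuclideanSpace ℝ (Fin N))} {ε : ℝ} (hΩ : AdmissibleDomain Ω ε)

include hΩ

lemma isCompact_closure : IsCompact (closure Ω) := hΩ.isBounded.isCompact_closure

lemma isCompact_frontier : IsCompact (frontier Ω) :=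
  hΩ.isCompact_closure.of_isClosed_subset isClosed_frontier frontier_subset_closure

lemma mem_or_mem_frontier {x : EuclideanSpace ℝ (Fin N)} (hx : x ∈ closure Ω) :
    x ∈ Ω ∨ x ∈ frontier Ω := by
  rw [closure_eq_self_union_frontier] at hx
  exact hx

lemma notMem_of_mem_frontier {x : EuclideanSpace ℝ (Fin N)} (hx : x ∈ frontier Ω) : x ∉ Ω := by
  rw [hΩ.isOpen.frontier_eq] at hx
  exact hx.2

lemma frontier_nonempty : (frontier Ω).Nonempty := by
  rw [Set.nonempty_iff_ne_empty]
  intro h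
  have hclopen : IsClopen Ω := isClopen_iff_frontier_eq_empty.2 h
  have hc : IsCompact Ω := by
    have := hΩ.isCompact_closure
    rwa [hclopen.1.closure_eq] at this
  exact hΩ.nonempty.ne_empty (isCompact_isOpen_eq_empty hΩ.dim_pos hc hΩ.isOpen)

lemma rEps_pos {x : EuclideanSpace ℝ (Fin N)} (hx : x ∈ Ω) : 0 < rEps ε Ω x := by
  refine lt_min hΩ.eps_pos ?_
  rw [← isClosed_frontier.notMem_iff_infDist_pos hΩ.frontier_nonempty]
  exact fun h => hΩ.notMem_of_mem_frontier h hx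

lemma ball_rEps_subset {x : EuclideanSpace ℝ (Fin N)} (hx : x ∈ Ω) :
    ball x (rEps ε Ω x) ⊆ Ω := by
  have hdisj : Disjoint (ball x (rEps ε Ω x)) (frontier Ω) := by
    rw [Set.disjoint_left]
    intro y hy hy'
    have := infDist_le_dist_of_mem (x := x) hy'
    rw [mem_ball, dist_comm] at hy
    exact absurd (hy.trans_le (min_le_right _ _)) (not_lt.2 this)
  refine (convex_ball x _).isPreconnected.subset_left_of_subset_union hΩ.isOpen
    isClosed_closure.isOpen_compl (v := (closure Ω)ᶜ)
    (Set.disjoint_left.2 fun y hy hy' => hy' (subset_closure hy)) ?_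
    ⟨x, mem_ball_self (hΩ.rEps_pos hx), hx⟩
  intro y hy
  by_cases h : y ∈ closure Ω
  · exact Or.inl ((hΩ.mem_or_mem_frontier h).resolve_right
      fun h' => Set.disjoint_left.1 hdisj hy h')
  · exact Or.inr h

lemma closedBall_rEps_subset {x : EuclideanSpace ℝ (Fin N)} (hx : x ∈ Ω) :
    closedBall x (rEps ε Ω x) ⊆ closure Ω := by
  rw [← closure_ball x (hΩ.rEps_pos hx).ne']
  exact closure_mono (hΩ.ball_rEps_subset hx)

lemma continuousOn_closedBall {x : EuclideanSpace ℝ (Fin N)} (hx : x ∈ Ω)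
    {v : EuclideanSpace ℝ (Fin N) → ℝ} (hv : ContinuousOn v (closure Ω)) :
    ContinuousOn v (closedBall x (rEps ε Ω x)) := hv.mono (hΩ.closedBall_rEps_subset hx)

omit hΩ in
lemma abs_rEps_sub_le (x y : EuclideanSpace ℝ (Fin N)) :
    |rEps ε Ω x - rEps ε Ω y| ≤ dist x y := by
  have h1 := infDist_le_infDist_add_dist (s := frontier Ω) (x := x) (y := y)
  have h2 := infDist_le_infDist_add_dist (s := frontier Ω) (x := y) (y := x)
  rw [dist_comm] at h2
  refine (abs_min_sub_min_le_max _ _ _ _).trans (max_le ?_ ?_)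
  · simp
  · rw [abs_sub_le_iff]
    constructor <;> linarith

omit hΩ in
lemma rEps_le_dist {x y : EuclideanSpace ℝ (Fin N)} (hy : y ∈ frontier Ω) :
    rEps ε Ω x ≤ dist x y := (min_le_right _ _).trans (infDist_le_dist_of_mem hy)

end AdmissibleDomain

section MuEps

variable {N : ℕ} {p : ℝ≥0∞} {Ω : Set (EuclideanSpace ℝ (Fin N))} {ε : ℝ}

lemma muEps_of_mem {v : EuclideanSpace ℝ (Fin N) → ℝ} {x : EuclideanSpace ℝ (Fin N)}
    (hx : x ∈ Ω) : muEps p ε Ω v x = pMean p (volume.restrict (ball x (rEps ε Ω x))) v := if_pos hx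

lemma muEps_of_notMem {v : EuclideanSpace ℝ (Fin N) → ℝ} {x : EuclideanSpace ℝ (Fin N)}
    (hx : x ∉ Ω) : muEps p ε Ω v x = v x := if_neg hx

variable (hΩ : AdmissibleDomain Ω ε)

include hΩ

lemma muEps_congr {v w : EuclideanSpace ℝ (Fin N) → ℝ} (h : ∀ x ∈ Ω, v x = w x)
    {x : EuclideanSpace ℝ (Fin N)} (hx : x ∈ Ω) : muEps p ε Ω v x = muEps p ε Ω w x := by
  rw [muEps_of_mem hx, muEps_of_mem hx]
  exact pMean_congr fun y hy => h y (hΩ.ball_rEps_subset hx hy)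

lemma muEps_mono (hp : 1 ≤ p) {v w : EuclideanSpace ℝ (Fin N) → ℝ}
    (hv : ContinuousOn v (closure Ω)) (hw : ContinuousOn w (closure Ω))
    (h : ∀ x ∈ closure Ω, v x ≤ w x) {x : EuclideanSpace ℝ (Fin N)} (hx : x ∈ Ω) :
    muEps p ε Ω v x ≤ muEps p ε Ω w x := by
  rw [muEps_of_mem hx, muEps_of_mem hx]
  exact pMean_mono hp (hΩ.rEps_pos hx) (hΩ.continuousOn_closedBall hx hv)
    (hΩ.continuousOn_closedBall hx hw) fun y hy => h y (hΩ.closedBall_rEps_subset hx hy)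

lemma muEps_mul_add (hp : 1 ≤ p) {v : EuclideanSpace ℝ (Fin N) → ℝ}
    (hv : ContinuousOn v (closure Ω)) (a c : ℝ) {x : EuclideanSpace ℝ (Fin N)} (hx : x ∈ Ω) :
    muEps p ε Ω (fun y => a * v y + c) x = a * muEps p ε Ω v x + c := by
  rw [muEps_of_mem hx, muEps_of_mem hx]
  exact pMean_mul_add hp (hΩ.rEps_pos hx) (hΩ.continuousOn_closedBall hx hv) a c

lemma muEps_neg (hp : 1 ≤ p) {v : EuclideanSpace ℝ (Fin N) → ℝ}
    (hv : ContinuousOn v (closure Ω)) {x : EuclideanSpace ℝ (Fin N)} (hx : x ∈ Ω) :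
    muEps p ε Ω (fun y => -v y) x = -muEps p ε Ω v x := by
  simpa using muEps_mul_add hΩ hp hv (-1) 0 hx

lemma muEps_const (hp : 1 ≤ p) (c : ℝ) {x : EuclideanSpace ℝ (Fin N)} (hx : x ∈ Ω) :
    muEps p ε Ω (fun _ => c) x = c := by
  rw [muEps_of_mem hx]
  exact pMean_const hp (hΩ.rEps_pos hx) c

/-- `μ_p^ε` preserves continuity up to the boundary. -/
lemma continuousOn_muEps (hp : 1 ≤ p) {v : EuclideanSpace ℝ (Fin N) → ℝ}
    (hv : ContinuousOn v (closure Ω)) : ContinuousOn (muEps p ε Ω v) (closure Ω) := by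
  have hunif := hΩ.isCompact_closure.uniformContinuousOn_of_continuous hv
  rw [Metric.uniformContinuousOn_iff_le] at hunif
  rw [Metric.continuousOn_iff]
  intro x hx η hη
  obtain ⟨δ, hδ, hvδ⟩ := hunif (η / 2) (half_pos hη)
  refine ⟨δ / 2, half_pos hδ, fun x' hx' hxx' => ?_⟩
  suffices |muEps p ε Ω v x' - muEps p ε Ω v x| ≤ η / 2 by
    rw [Real.dist_eq]; linarith
  have bdry : ∀ x ∈ Ω, ∀ x₀ ∈ frontier Ω, dist x x₀ < δ / 2 →
      |muEps p ε Ω v x - muEps p ε Ω v x₀| ≤ η / 2 := by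
    intro x hx x₀ hx₀ hd
    rw [muEps_of_notMem (hΩ.notMem_of_mem_frontier hx₀), muEps_of_mem hx,
      ← pMean_const hp (hΩ.rEps_pos hx) (v x₀)]
    refine abs_pMean_sub_le hp (hΩ.rEps_pos hx) (hΩ.continuousOn_closedBall hx hv)
      continuousOn_const fun y hy => ?_
    refine hvδ y (hΩ.closedBall_rEps_subset hx hy) x₀ (frontier_subset_closure hx₀) ?_
    have h1 := AdmissibleDomain.rEps_le_dist (ε := ε) (x := x) hx₀
    have h2 := dist_triangle y x x₀
    rw [mem_closedBall] at hy
    linarith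
  rcases hΩ.mem_or_mem_frontier hx with hxΩ | hxΓ <;>
    rcases hΩ.mem_or_mem_frontier hx' with hxΩ' | hxΓ'
  · have hr := hΩ.rEps_pos hxΩ
    have hr' := hΩ.rEps_pos hxΩ'
    rw [muEps_of_mem hxΩ, muEps_of_mem hxΩ', pMean_rescale (x := x) hr hr' v]
    have hmaps : ∀ y ∈ closedBall x (rEps ε Ω x),
        x' + (rEps ε Ω x' / rEps ε Ω x) • (y - x) ∈ closure Ω := by
      intro y hy
      refine hΩ.closedBall_rEps_subset hxΩ' ?_
      rw [mem_closedBall, dist_eq_norm] at hy ⊢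
      rw [add_sub_cancel_left, norm_smul, Real.norm_eq_abs, abs_of_pos (div_pos hr' hr),
        div_mul_eq_mul_div, div_le_iff₀ hr]
      exact mul_le_mul_of_nonneg_left hy hr'.le
    refine abs_pMean_sub_le hp hr (hv.comp (by fun_prop) hmaps)
      (hΩ.continuousOn_closedBall hxΩ hv) fun y hy => ?_
    refine hvδ _ (hmaps y hy) y (hΩ.closedBall_rEps_subset hxΩ hy) ?_
    have h1 := AdmissibleDomain.abs_rEps_sub_le (ε := ε) (Ω := Ω) x' x
    rw [mem_closedBall, dist_eq_norm] at hy
    have e : x' + (rEps ε Ω x' / rEps ε Ω x) • (y - x) - y =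
        (x' - x) + ((rEps ε Ω x' - rEps ε Ω x) / rEps ε Ω x) • (y - x) := by
      rw [sub_div, div_self hr.ne', sub_smul, one_smul]
      abel
    rw [dist_eq_norm, e]
    refine (norm_add_le _ _).trans ?_
    have h2 : ‖((rEps ε Ω x' - rEps ε Ω x) / rEps ε Ω x) • (y - x)‖ ≤ dist x' x := by
      rw [norm_smul, Real.norm_eq_abs, abs_div, abs_of_pos hr, div_mul_eq_mul_div,
        div_le_iff₀ hr]
      exact mul_le_mul h1 hy (norm_nonneg _) dist_nonneg
    rw [← dist_eq_norm]
    linarith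
  · rw [abs_sub_comm]
    exact bdry x hxΩ x' hxΓ' (by rwa [dist_comm])
  · exact bdry x' hxΩ' x hxΓ hxx'
  · rw [muEps_of_notMem (hΩ.notMem_of_mem_frontier hxΓ),
      muEps_of_notMem (hΩ.notMem_of_mem_frontier hxΓ')]
    refine hvδ x' hx' x hx (by linarith)

end MuEps

section HalfBall

variable {N : ℕ}

/-- The open half of the ball `ball x r` lying in direction `e`. -/
def halfBall (e x : EuclideanSpace ℝ (Fin N)) (r : ℝ) : Set (EuclideanSpace ℝ (Fin N)) :=
  {y | y ∈ ball x r ∧ 0 < inner ℝ e (y - x)}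

variable {e x y : EuclideanSpace ℝ (Fin N)} {r : ℝ}

lemma halfBall_subset_ball : halfBall e x r ⊆ ball x r := fun _ h => h.1

lemma isOpen_halfBall : IsOpen (halfBall e x r) :=
  by
  have hc : Continuous fun y : EuclideanSpace ℝ (Fin N) => (inner ℝ e (y - x) : ℝ) := by fun_prop
  exact isOpen_ball.inter (isOpen_lt continuous_const hc)

lemma convex_halfBall : Convex ℝ (halfBall e x r) := by
  rintro a ⟨ha', ha⟩ b ⟨hb', hb⟩ s t hs ht hst
  refine ⟨convex_ball x r ha' hb' hs ht hst, ?_⟩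
  have h : s • a + t • b - x = s • (a - x) + t • (b - x) := by
    obtain rfl : t = 1 - s := by linarith
    module
  rw [h, inner_add_right, real_inner_smul_right, real_inner_smul_right]
  rcases hs.eq_or_lt with rfl | hs
  · obtain rfl : t = 1 := by linarith
    simpa using hb
  · have := mul_pos hs ha
    have := mul_nonneg ht hb.le
    linarith

lemma volume_hyperplane (he : e ≠ 0) (x : EuclideanSpace ℝ (Fin N)) :
    volume {y | inner ℝ e (y - x) = 0} = 0 := by
  have h : volume ((LinearMap.ker (innerSL ℝ e).toLinearMap :
      Submodule ℝ (EuclideanSpace ℝ (Fin N))) : Set (EuclideanSpace ℝ (Fin N))) = 0 := by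
    refine Measure.addHaar_submodule _ _ fun h => he ?_
    have : e ∈ LinearMap.ker (innerSL ℝ e).toLinearMap := h ▸ Submodule.mem_top
    simpa using this
  rw [← (measurePreserving_sub_right volume x).measure_preimage
    (Submodule.closed_of_finiteDimensional _).measurableSet.nullMeasurableSet] at h
  convert h using 2
  ext y
  simp

lemma volume_halfBall_neg : volume (halfBall (-e) x r) = volume (halfBall e x r) := by
  have hm : MeasurableSet (halfBall e x r) := isOpen_halfBall.measurableSet
  have hpre := (Measure.measurePreserving_sub_left volume (x + x)).measure_preimage hm.nullMeasurableSet
  rw [← hpre]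
  congr 1
  ext y
  have h : x + x - y - x = -(y - x) := by abel
  simp only [halfBall, Set.mem_preimage, Set.mem_ofPred_eq, mem_ball, dist_eq_norm, h, norm_neg,
    inner_neg_left, inner_neg_right]

lemma ball_ae_eq_halfBall_union (he : e ≠ 0) :
    ball x r =ᵐ[volume] (halfBall e x r ∪ halfBall (-e) x r : Set _) := by
  have h0 : ∀ᵐ y, ¬ inner ℝ e (y - x) = 0 := by
    rw [ae_iff]
    simpa using volume_hyperplane he x
  filter_upwards [h0] with y hy
  apply propext
  change y ∈ ball x r ↔ y ∈ halfBall e x r ∪ halfBall (-e) x r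
  refine ⟨fun h => ?_, fun h => h.elim (·.1) (·.1)⟩
  rcases lt_or_gt_of_ne hy with h' | h'
  · exact Or.inr ⟨h, by rw [inner_neg_left]; linarith⟩
  · exact Or.inl ⟨h, h'⟩

lemma volume_ball_eq_two_mul_halfBall (he : e ≠ 0) :
    volume (ball x r) = 2 * volume (halfBall e x r) := by
  rw [measure_congr (ball_ae_eq_halfBall_union he),
    measure_union _ isOpen_halfBall.measurableSet, volume_halfBall_neg, two_mul]
  rw [Set.disjoint_left]
  rintro y ⟨-, h⟩ ⟨-, h'⟩
  rw [inner_neg_left] at h'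
  linarith

lemma volume_halfBall_ne_top : volume (halfBall e x r) ≠ ⊤ :=
  ((measure_mono halfBall_subset_ball).trans_lt measure_ball_lt_top).ne

lemma mem_closure_halfBall (he : e ≠ 0) (hy : y ∈ ball x r) (hye : inner ℝ e (y - x) = 0) :
    y ∈ closure (halfBall e x r) := by
  have hlim : Tendsto (fun t : ℝ => y + t • e) (𝓝[>] 0) (𝓝 y) := by
    have : Tendsto (fun t : ℝ => y + t • e) (𝓝 0) (𝓝 (y + (0 : ℝ) • e)) :=
      Continuous.tendsto (by fun_prop) 0
    rw [zero_smul, add_zero] at this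
    exact this.mono_left nhdsWithin_le_nhds
  refine mem_closure_of_tendsto hlim ?_
  filter_upwards [hlim.eventually (isOpen_ball.mem_nhds hy), self_mem_nhdsWithin] with t ht ht0
  refine ⟨ht, ?_⟩
  have h : y + t • e - x = (y - x) + t • e := by abel
  rw [h, inner_add_right, hye, real_inner_smul_right, zero_add]
  exact mul_pos ht0 (real_inner_self_pos.2 he)

lemma halfBall_subset_of_volume {A : Set (EuclideanSpace ℝ (Fin N))} (he : e ≠ 0)
    (hA : IsClosed A) (hvol : volume (ball x r) ≤ 2 * volume (ball x r ∩ A))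
    (hdisj : Disjoint (halfBall e x r) A) : halfBall (-e) x r ⊆ A := by
  have hopen : IsOpen (halfBall (-e) x r \ A) := isOpen_halfBall.sdiff hA
  have h1 : volume (ball x r ∩ A) = volume (halfBall (-e) x r ∩ A) := by
    refine measure_congr ?_
    filter_upwards [ball_ae_eq_halfBall_union (x := x) (r := r) he] with y hy
    have hy : y ∈ ball x r ↔ y ∈ halfBall e x r ∪ halfBall (-e) x r := iff_of_eq hy
    apply propext
    change y ∈ ball x r ∩ A ↔ y ∈ halfBall (-e) x r ∩ A
    rw [Set.mem_inter_iff, Set.mem_inter_iff, hy]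
    constructor
    · rintro ⟨h | h, h'⟩
      · exact absurd h' (Set.disjoint_left.1 hdisj h)
      · exact ⟨h, h'⟩
    · rintro ⟨h, h'⟩
      exact ⟨Or.inr h, h'⟩
  rw [volume_ball_eq_two_mul_halfBall (neg_ne_zero.2 he), h1] at hvol
  have h2 : volume (halfBall (-e) x r) ≤ volume (halfBall (-e) x r ∩ A) :=
    (ENNReal.mul_le_mul_iff_right (by simp) (by simp)).1 hvol
  have h3 : volume (halfBall (-e) x r \ A) = 0 := by
    have := measure_inter_add_sdiff (μ := volume) (halfBall (-e) x r) hA.measurableSet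
    by_contra h
    have h4 := ENNReal.lt_add_right (a := volume (halfBall (-e) x r ∩ A))
      ((measure_mono Set.inter_subset_left).trans_lt volume_halfBall_ne_top.lt_top).ne h
    rw [this] at h4
    exact absurd h4 (not_lt.2 h2)
  rw [hopen.measure_eq_zero_iff volume] at h3
  exact Set.sdiff_eq_empty.1 h3

lemma mem_closure_diff_of_volume {A : Set (EuclideanSpace ℝ (Fin N))} (he : e ≠ 0)
    (hA : IsClosed A) (hvol : 2 * volume (ball x r ∩ A) ≤ volume (ball x r))
    (hsub : halfBall e x r ⊆ A) (hy : y ∈ ball x r) (hye : inner ℝ e (y - x) = 0) :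
    y ∈ closure (ball x r \ A) := by
  have hnull : volume (halfBall (-e) x r ∩ A) = 0 := by
    rw [volume_ball_eq_two_mul_halfBall he] at hvol
    have h2 : volume (ball x r ∩ A) ≤ volume (halfBall e x r) :=
      (ENNReal.mul_le_mul_iff_right (by simp) (by simp)).1 hvol
    by_contra h
    have h4 := ENNReal.lt_add_right (a := volume (halfBall e x r)) volume_halfBall_ne_top h
    rw [← measure_union (Set.disjoint_left.2 ?_)
      (isOpen_halfBall.measurableSet.inter hA.measurableSet)] at h4
    · refine absurd (h4.trans_le (measure_mono ?_)) (not_lt.2 h2)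
      exact Set.union_subset (fun z hz => ⟨hz.1, hsub hz⟩) fun z hz => ⟨hz.1.1, hz.2⟩
    · rintro z ⟨-, hz⟩ ⟨⟨-, hz'⟩, -⟩
      rw [inner_neg_left] at hz'
      linarith
  have hcl := mem_closure_halfBall (neg_ne_zero.2 he) hy (by rw [inner_neg_left, hye, neg_zero])
  have hdense : halfBall (-e) x r ⊆ closure (ball x r \ A) := by
    intro z hz
    rw [_root_.mem_closure_iff]
    intro V hV hzV
    by_contra hne
    have hsub' : V ∩ halfBall (-e) x r ⊆ halfBall (-e) x r ∩ A := by
      rintro a ⟨haV, ha⟩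
      refine ⟨ha, ?_⟩
      by_contra haA
      exact hne ⟨a, haV, ha.1, haA⟩
    have : V ∩ halfBall (-e) x r = ∅ :=
      ((hV.inter isOpen_halfBall).measure_eq_zero_iff volume).1 (measure_mono_null hsub' hnull)
    exact Set.notMem_empty z (this ▸ ⟨hzV, hz⟩)
  exact closure_minimal hdense isClosed_closure hcl

/-- A compact set has a point which is extremal in a direction `e`, and also extremal along an
orthogonal direction `f` through that point. -/
lemma exists_extremal (hN : 2 ≤ N) {K : Set (EuclideanSpace ℝ (Fin N))} (hK : IsCompact K)
    (hne : K.Nonempty) : ∃ x ∈ K, ∃ e f : EuclideanSpace ℝ (Fin N), e ≠ 0 ∧ f ≠ 0 ∧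
      inner ℝ e f = 0 ∧ (∀ y ∈ K, inner ℝ e (y - x) ≤ 0) ∧ ∀ t : ℝ, 0 < t → x + t • f ∉ K := by
  set i : Fin N := ⟨0, by omega⟩
  set j : Fin N := ⟨1, by omega⟩
  set e : EuclideanSpace ℝ (Fin N) := EuclideanSpace.single i 1
  set f : EuclideanSpace ℝ (Fin N) := EuclideanSpace.single j 1
  have hij : i ≠ j := by simp [i, j]
  have hef : inner ℝ e f = 0 := by simp [e, f, EuclideanSpace.inner_single_left, hij]
  have he : e ≠ 0 := by simp [e]
  have hf : f ≠ 0 := by simp [f]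
  obtain ⟨a, ha, hmax⟩ := hK.exists_isMaxOn hne
    (f := fun y => inner ℝ e y) (by fun_prop)
  have hK' : IsCompact (K ∩ {y | inner ℝ e a ≤ inner ℝ e y}) :=
    hK.inter_right (isClosed_le continuous_const (by fun_prop))
  obtain ⟨x, ⟨hx, hax⟩, hmax'⟩ := hK'.exists_isMaxOn ⟨a, ha, le_refl (inner ℝ e a)⟩
    (f := fun y => inner ℝ f y) (by fun_prop)
  refine ⟨x, hx, e, f, he, hf, hef, fun y hy => ?_, fun t ht hmem => ?_⟩
  · rw [inner_sub_right]
    have : inner ℝ e y ≤ inner ℝ e a := hmax hy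
    have h' : inner ℝ e a ≤ inner ℝ e x := hax
    linarith
  · have h' : inner ℝ e a ≤ inner ℝ e x := hax
    have : inner ℝ f (x + t • f) ≤ inner ℝ f x := hmax' ⟨hmem, by
      rw [Set.mem_ofPred_eq, inner_add_right, real_inner_smul_right, hef]; linarith⟩
    rw [inner_add_right, real_inner_smul_right] at this
    have := mul_pos ht (real_inner_self_pos.2 hf)
    linarith

end HalfBall

section Density

variable {N : ℕ}

lemma ball_subset_of_ae {K : Set (EuclideanSpace ℝ (Fin N))} (hK : IsClosed K)
    {x : EuclideanSpace ℝ (Fin N)} {r : ℝ} (h : ∀ᵐ y ∂volume.restrict (ball x r), y ∈ K) :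
    ball x r ⊆ K := by
  rw [ae_restrict_iff' measurableSet_ball, ae_iff] at h
  have hopen : IsOpen (ball x r \ K) := isOpen_ball.sdiff hK
  have h0 : volume (ball x r \ K) = 0 := by
    convert h using 2
    ext y
    simp
  rw [hopen.measure_eq_zero_iff volume] at h0
  exact Set.sdiff_eq_empty.1 h0

lemma eq_empty_of_ball_subset (hN : 0 < N) {K : Set (EuclideanSpace ℝ (Fin N))}
    (hK : IsCompact K) (h : ∀ x ∈ K, ∃ r > 0, ball x r ⊆ K) : K = ∅ :=
  isCompact_isOpen_eq_empty hN hK (Metric.isOpen_iff.2 h)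

lemma eventually_add_smul_mem_ball (x f : EuclideanSpace ℝ (Fin N)) {r : ℝ} (hr : 0 < r) :
    ∃ t : ℝ, 0 < t ∧ x + t • f ∈ ball x r := by
  have hlim : Tendsto (fun t : ℝ => x + t • f) (𝓝[>] 0) (𝓝 x) := by
    have : Tendsto (fun t : ℝ => x + t • f) (𝓝 0) (𝓝 (x + (0 : ℝ) • f)) :=
      Continuous.tendsto (by fun_prop) 0
    rw [zero_smul, add_zero] at this
    exact this.mono_left nhdsWithin_le_nhds
  obtain ⟨t, ht, ht'⟩ := ((hlim.eventually (ball_mem_nhds x hr)).and self_mem_nhdsWithin).exists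
  exact ⟨t, ht', ht⟩

/-- In dimension at least two, no nonempty compact set fills at least half of some ball around
each of its points. -/
lemma eq_empty_of_half_volume (hN : 2 ≤ N) {K : Set (EuclideanSpace ℝ (Fin N))}
    (hK : IsCompact K)
    (h : ∀ x ∈ K, ∃ r > 0, volume (ball x r) ≤ 2 * volume (ball x r ∩ K)) : K = ∅ := by
  by_contra hne
  obtain ⟨x, hx, e, f, he, -, hef, hmax, hf⟩ :=
    exists_extremal hN hK (Set.nonempty_iff_ne_empty.2 hne)
  obtain ⟨r, hr, hvol⟩ := h x hx
  have hsub := halfBall_subset_of_volume he hK.isClosed hvol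
    (Set.disjoint_left.2 fun y hy hy' => not_lt.2 (hmax y hy') hy.2)
  obtain ⟨t, ht, htb⟩ := eventually_add_smul_mem_ball x f hr
  refine hf t ht (closure_minimal hsub hK.isClosed
    (mem_closure_halfBall (neg_ne_zero.2 he) htb ?_))
  rw [add_sub_cancel_left, real_inner_smul_right, inner_neg_left, hef, neg_zero, mul_zero]

lemma integral_signedPow_one_nonneg_iff {F : EuclideanSpace ℝ (Fin N) → ℝ} {t r : ℝ}
    {x : EuclideanSpace ℝ (Fin N)} {A : Set (EuclideanSpace ℝ (Fin N))} (hA : MeasurableSet A)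
    (h : ∀ y ∈ ball x r, y ∈ A ↔ t ≤ F y) :
    0 ≤ ∫ y in ball x r, signedPow 1 (F y - t) ↔
      volume (ball x r) ≤ 2 * volume (ball x r ∩ A) := by
  have e1 : ∫ y in ball x r, signedPow 1 (F y - t) =
      ∫ y in ball x r, (A.indicator (fun _ => (2 : ℝ)) y - 1) := by
    refine setIntegral_congr_fun measurableSet_ball fun y hy => ?_
    by_cases hyA : y ∈ A
    · have := (h y hy).1 hyA
      simp only [Set.indicator_of_mem hyA]
      rw [signedPow_of_nonneg (by linarith), sub_self, Real.rpow_zero]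
      norm_num
    · have := fun h' => hyA ((h y hy).2 h')
      simp only [Set.indicator_of_notMem hyA]
      rw [signedPow_of_neg (by linarith [not_le.1 this]), sub_self, Real.rpow_zero]
      norm_num
  have hb : volume (ball x r) ≠ ⊤ := measure_ball_lt_top.ne
  have hbA : volume (ball x r ∩ A) ≠ ⊤ :=
    ((measure_mono Set.inter_subset_left).trans_lt measure_ball_lt_top).ne
  rw [e1, integral_sub ((integrable_const _).indicator hA) (integrable_const _),
    integral_indicator_const _ hA, integral_const, measureReal_restrict_apply hA,
    measureReal_restrict_apply_univ, Set.inter_comm A]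
  simp only [smul_eq_mul, mul_one, sub_nonneg, Measure.real]
  rw [mul_comm, ← ENNReal.toReal_ofNat, ← ENNReal.toReal_mul,
    ENNReal.toReal_le_toReal hb (ENNReal.mul_ne_top (by simp) hbA)]

end Density

section MaximumPrinciple

variable {N : ℕ} {p : ℝ≥0∞} {Ω : Set (EuclideanSpace ℝ (Fin N))} {ε : ℝ}

lemma ne_top_one_or_one_lt (hp : 1 ≤ p) : p = ⊤ ∨ p = 1 ∨ (p ≠ ⊤ ∧ 1 < p.toReal) := by
  rcases eq_or_ne p ⊤ with h | h
  · exact Or.inl h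
  rcases hp.eq_or_lt with h' | h'
  · exact Or.inr (Or.inl h'.symm)
  · refine Or.inr (Or.inr ⟨h, ?_⟩)
    rw [← ENNReal.toReal_one]
    exact ENNReal.toReal_strict_mono h h'

variable (hΩ : AdmissibleDomain Ω ε)

include hΩ

/-- The maximum principle for subsolutions. -/
lemma le_of_mem_SgLower (hp : 1 ≤ p) (hNp : 2 ≤ N ∨ p ≠ 1)
    {g v : EuclideanSpace ℝ (Fin N) → ℝ} (hv : v ∈ SgLower p ε Ω g) {L : ℝ}
    (hL : ∀ x ∈ frontier Ω, g x ≤ L) {x : EuclideanSpace ℝ (Fin N)} (hx : x ∈ closure Ω) :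
    v x ≤ L := by
  obtain ⟨hvc, hvμ, hvg⟩ := hv
  obtain ⟨a, ha, hmax⟩ := hΩ.isCompact_closure.exists_isMaxOn hΩ.nonempty.closure hvc
  refine (hmax hx : v x ≤ v a).trans ?_
  by_contra! hLa
  set K := closure Ω ∩ v ⁻¹' Set.Ici (v a) with hKdef
  have hKcl : IsClosed K := hvc.preimage_isClosed_of_isClosed isClosed_closure isClosed_Ici
  have hK : IsCompact K := hΩ.isCompact_closure.of_isClosed_subset hKcl Set.inter_subset_left
  have hKΩ : K ⊆ Ω := fun y hy => (hΩ.mem_or_mem_frontier hy.1).resolve_right fun h => by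
    have h1 := hvg y h
    have h2 := hL y h
    have h3 : v a ≤ v y := hy.2
    linarith
  have hKne : K ≠ ∅ := Set.Nonempty.ne_empty ⟨a, ha, le_refl (v a)⟩
  have hKv : ∀ y ∈ K, v y = v a := fun y hy => le_antisymm (hmax hy.1) hy.2
  rcases ne_top_one_or_one_lt hp with rfl | rfl | ⟨hp', hq⟩
  · refine hKne (eq_empty_of_ball_subset hΩ.dim_pos hK fun y hy =>
      ⟨_, hΩ.rEps_pos (hKΩ hy), fun z hz => ⟨subset_closure (hΩ.ball_rEps_subset (hKΩ hy) hz), ?_⟩⟩)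
    obtain ⟨c, hc, d, hd, hcd, e⟩ :=
      exists_pMean_top_eq (hΩ.rEps_pos (hKΩ hy)) (hΩ.continuousOn_closedBall (hKΩ hy) hvc)
    have h1 := hvμ y (hKΩ hy)
    rw [muEps_of_mem (hKΩ hy), e, hKv y hy] at h1
    have h2 : v c ≤ v a := hmax (hΩ.closedBall_rEps_subset (hKΩ hy) hc)
    have h3 := (hcd z (ball_subset_closedBall hz)).1
    change v a ≤ v z
    linarith
  · refine hKne (eq_empty_of_half_volume (hNp.resolve_right (by simp)) hK fun y hy =>
      ⟨_, hΩ.rEps_pos (hKΩ hy), ?_⟩)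
    have h1 := hvμ y (hKΩ hy)
    rw [muEps_of_mem (hKΩ hy), le_pMean_iff le_rfl (by simp) (hΩ.rEps_pos (hKΩ hy))
      (hΩ.continuousOn_closedBall (hKΩ hy) hvc), ENNReal.toReal_one, hKv y hy] at h1
    refine (integral_signedPow_one_nonneg_iff hKcl.measurableSet fun z hz => ?_).1 h1
    exact ⟨fun h => h.2, fun h => ⟨subset_closure (hΩ.ball_rEps_subset (hKΩ hy) hz), h⟩⟩
  · refine hKne (eq_empty_of_ball_subset hΩ.dim_pos hK fun y hy =>
      ⟨_, hΩ.rEps_pos (hKΩ hy), ball_subset_of_ae hKcl ?_⟩)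
    have h1 := hvμ y (hKΩ hy)
    have hcb := hΩ.continuousOn_closedBall (hKΩ hy) hvc
    rw [muEps_of_mem (hKΩ hy), le_pMean_iff hp hp' (hΩ.rEps_pos (hKΩ hy)) hcb, hKv y hy] at h1
    obtain ⟨C, hC⟩ := exists_abs_le_of_continuousOn_closedBall hcb
    have hinteg := integrable_signedPow (μ := volume.restrict (ball y (rEps ε Ω y))) hq.le
      (aemeasurable_restrict_ball hcb)
      (ae_restrict_ball_of_forall fun z hz => hC z (ball_subset_closedBall hz)) (v a)
    have hneg : 0 ≤ᵐ[volume.restrict (ball y (rEps ε Ω y))]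
        fun z => -signedPow p.toReal (v z - v a) := by
      refine ae_restrict_ball_of_forall fun z hz => ?_
      have h2 : v z ≤ v a := hmax (subset_closure (hΩ.ball_rEps_subset (hKΩ hy) hz))
      have h3 := signedPow_mono hq.le (sub_nonpos.2 h2)
      rw [signedPow_zero hq] at h3
      simpa using h3
    have h0 : ∫ z in ball y (rEps ε Ω y), -signedPow p.toReal (v z - v a) = 0 := by
      refine le_antisymm ?_ (integral_nonneg_of_ae hneg)
      rw [integral_neg]
      linarith
    rw [integral_eq_zero_iff_of_nonneg_ae hneg hinteg.neg] at h0
    filter_upwards [h0, ae_restrict_mem measurableSet_ball] with z hz hzb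
    refine ⟨subset_closure (hΩ.ball_rEps_subset (hKΩ hy) hzb), ?_⟩
    have h2 : signedPow p.toReal (v z - v a) = signedPow p.toReal 0 := by
      rw [signedPow_zero hq]
      simpa using hz
    have h3 := (signedPow_strictMono hq).injective h2
    exact (sub_eq_zero.1 h3).ge

end MaximumPrinciple

section Perron

variable {N : ℕ} {p : ℝ≥0∞} {Ω : Set (EuclideanSpace ℝ (Fin N))} {ε : ℝ}
  {g : EuclideanSpace ℝ (Fin N) → ℝ}

lemma isClosed_inter_preimage_Ici {s : Set (EuclideanSpace ℝ (Fin N))} (hs : IsClosed s)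
    {F : EuclideanSpace ℝ (Fin N) → ℝ} (hF : UpperSemicontinuousOn F s) (c : ℝ) :
    IsClosed (s ∩ F ⁻¹' Set.Ici c) := by
  refine isClosed_of_closure_subset fun x hx => ?_
  have hxs : x ∈ s := closure_minimal Set.inter_subset_left hs hx
  refine ⟨hxs, ?_⟩
  by_contra hlt
  have hlt : F x < c := not_le.1 hlt
  have h1 := hF x hxs c hlt
  rw [eventually_nhdsWithin_iff] at h1
  obtain ⟨y, hy, hy'⟩ := (mem_closure_iff_frequently.1 hx).and_eventually h1 |>.exists
  exact not_lt.2 (show c ≤ F y from hy.2) (hy' hy.1)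

variable (hΩ : AdmissibleDomain Ω ε)

include hΩ

lemma neg_mem_SgLower (hp : 1 ≤ p) {v : EuclideanSpace ℝ (Fin N) → ℝ}
    (hv : v ∈ SgUpper p ε Ω g) : (fun x => -v x) ∈ SgLower p ε Ω fun x => -g x := by
  obtain ⟨h1, h2, h3⟩ := hv
  refine ⟨h1.neg, fun x hx => ?_, fun x hx => neg_le_neg (h3 x hx)⟩
  rw [muEps_neg hΩ hp h1 hx]
  exact neg_le_neg (h2 x hx)

lemma neg_mem_SgUpper (hp : 1 ≤ p) {v : EuclideanSpace ℝ (Fin N) → ℝ}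
    (hv : v ∈ SgLower p ε Ω g) : (fun x => -v x) ∈ SgUpper p ε Ω fun x => -g x := by
  obtain ⟨h1, h2, h3⟩ := hv
  refine ⟨h1.neg, fun x hx => ?_, fun x hx => neg_le_neg (h3 x hx)⟩
  rw [muEps_neg hΩ hp h1 hx]
  exact neg_le_neg (h2 x hx)

lemma lowerPerron_eq_neg (hp : 1 ≤ p) (x : EuclideanSpace ℝ (Fin N)) :
    lowerPerron p ε Ω g x = -upperPerron p ε Ω (fun y => -g y) x := by
  rw [lowerPerron, upperPerron, ← Real.sSup_neg]
  congr 1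
  ext a
  simp only [Set.mem_image, Set.mem_neg]
  constructor
  · rintro ⟨v, hv, rfl⟩
    exact ⟨_, neg_mem_SgUpper hΩ hp hv, rfl⟩
  · rintro ⟨v, hv, h⟩
    refine ⟨fun y => -v y, ?_, neg_eq_iff_eq_neg.2 h⟩
    simpa using neg_mem_SgLower hΩ hp hv

lemma min_mem_SgUpper (hp : 1 ≤ p) {v w : EuclideanSpace ℝ (Fin N) → ℝ}
    (hv : v ∈ SgUpper p ε Ω g) (hw : w ∈ SgUpper p ε Ω g) :
    (fun x => min (v x) (w x)) ∈ SgUpper p ε Ω g := by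
  obtain ⟨hv1, hv2, hv3⟩ := hv
  obtain ⟨hw1, hw2, hw3⟩ := hw
  refine ⟨hv1.inf hw1, fun x hx => le_min ?_ ?_, fun x hx => le_min (hv3 x hx) (hw3 x hx)⟩
  · exact (muEps_mono hΩ hp (hv1.inf hw1) hv1 (fun y _ => min_le_left _ _) hx).trans (hv2 x hx)
  · exact (muEps_mono hΩ hp (hv1.inf hw1) hw1 (fun y _ => min_le_right _ _) hx).trans (hw2 x hx)

lemma muEps_mem_SgUpper (hp : 1 ≤ p) {v : EuclideanSpace ℝ (Fin N) → ℝ}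
    (hv : v ∈ SgUpper p ε Ω g) : muEps p ε Ω v ∈ SgUpper p ε Ω g := by
  obtain ⟨hv1, hv2, hv3⟩ := hv
  refine ⟨continuousOn_muEps hΩ hp hv1, fun x hx => ?_, fun x hx => ?_⟩
  · refine muEps_mono hΩ hp (continuousOn_muEps hΩ hp hv1) hv1 (fun y hy => ?_) hx
    by_cases hy' : y ∈ Ω
    · exact hv2 y hy'
    · rw [muEps_of_notMem hy']
  · rw [muEps_of_notMem (hΩ.notMem_of_mem_frontier hx)]
    exact hv3 x hx

lemma SgUpper_nonempty (hp : 1 ≤ p) (hg : ContinuousOn g (frontier Ω)) :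
    (SgUpper p ε Ω g).Nonempty := by
  obtain ⟨C, hC⟩ := hΩ.isCompact_frontier.exists_bound_of_continuousOn hg
  exact ⟨fun _ => C, continuousOn_const, fun x hx => (muEps_const hΩ hp C hx).le,
    fun x hx => (le_abs_self _).trans (hC x hx)⟩

/-- A barrier yields supersolutions nearly attaining the boundary value. -/
lemma exists_mem_SgUpper_le (hp : 1 ≤ p) (hg : ContinuousOn g (frontier Ω))
    {x₀ : EuclideanSpace ℝ (Fin N)} (hx₀ : x₀ ∈ frontier Ω)
    (hreg : ∃ w, IsBarrier p ε Ω x₀ w) {η : ℝ} (hη : 0 < η) :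
    ∃ v ∈ SgUpper p ε Ω g, v x₀ = g x₀ + η := by
  obtain ⟨b, hb1, hb2, hb3, hb4⟩ := hreg
  have hb0 : ∀ x ∈ closure Ω, 0 ≤ b x := fun x hx => by
    rcases eq_or_ne x x₀ with rfl | h
    · exact hb4.ge
    · exact (hb3 x hx h).le
  obtain ⟨C, hC0, hC⟩ : ∃ C : ℝ, 0 ≤ C ∧ ∀ x ∈ frontier Ω, g x ≤ C * b x + (g x₀ + η) := by
    set K := frontier Ω ∩ g ⁻¹' Set.Ici (g x₀ + η)
    have hK : IsCompact K := hΩ.isCompact_frontier.of_isClosed_subset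
      (hg.preimage_isClosed_of_isClosed isClosed_frontier isClosed_Ici) Set.inter_subset_left
    obtain ⟨M, hM⟩ := hΩ.isCompact_frontier.exists_bound_of_continuousOn hg
    rcases K.eq_empty_or_nonempty with hKe | hKne
    · refine ⟨0, le_rfl, fun x hx => ?_⟩
      rw [zero_mul, zero_add]
      by_contra! h
      exact Set.notMem_empty x (hKe ▸ ⟨hx, h.le⟩)
    · obtain ⟨a, ha, hmin⟩ := hK.exists_isMinOn hKne
        (hb1.mono (Set.inter_subset_left.trans frontier_subset_closure))
      have hba : 0 < b a := hb3 a (frontier_subset_closure ha.1) fun h => by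
        have : g x₀ + η ≤ g a := ha.2
        rw [h] at this
        linarith
      have hM0 : 0 ≤ M := (norm_nonneg _).trans (hM x₀ hx₀)
      refine ⟨2 * M / b a, by positivity, fun x hx => ?_⟩
      by_cases hxK : g x₀ + η ≤ g x
      · have h1 : b a ≤ b x := hmin ⟨hx, hxK⟩
        have h2 : 2 * M ≤ 2 * M / b a * b x := by
          rw [div_mul_eq_mul_div, le_div_iff₀ hba]
          gcongr
        have h3 := abs_le.1 (hM x hx)
        have h4 := abs_le.1 (hM x₀ hx₀)
        linarith [h3.2, h4.1]
      · have : 0 ≤ 2 * M / b a * b x :=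
          mul_nonneg (by positivity) (hb0 x (frontier_subset_closure hx))
        linarith
  refine ⟨fun x => C * b x + (g x₀ + η), ⟨?_, fun x hx => ?_, hC⟩, by simp [hb4]⟩
  · exact (continuousOn_const.mul hb1).add continuousOn_const
  · rw [muEps_mul_add hΩ hp hb1 C _ hx]
    have := mul_le_mul_of_nonneg_left (hb2 x hx) hC0
    linarith

lemma upperPerron_eq_of_mem_frontier (hp : 1 ≤ p) (hg : ContinuousOn g (frontier Ω))
    {x₀ : EuclideanSpace ℝ (Fin N)} (hx₀ : x₀ ∈ frontier Ω)
    (hreg : ∃ w, IsBarrier p ε Ω x₀ w) : upperPerron p ε Ω g x₀ = g x₀ := by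
  have hlb : g x₀ ∈ lowerBounds ((fun v => v x₀) '' SgUpper p ε Ω g) := by
    rintro _ ⟨v, hv, rfl⟩
    exact hv.2.2 x₀ hx₀
  refine le_antisymm (le_of_forall_pos_le_add fun η hη => ?_)
    (le_csInf ((SgUpper_nonempty hΩ hp hg).image _) hlb)
  obtain ⟨v, hv, e⟩ := exists_mem_SgUpper_le hΩ hp hg hx₀ hreg hη
  rw [← e]
  exact csInf_le ⟨_, hlb⟩ ⟨v, hv, rfl⟩

lemma lowerPerron_eq_of_mem_frontier (hp : 1 ≤ p) (hg : ContinuousOn g (frontier Ω))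
    {x₀ : EuclideanSpace ℝ (Fin N)} (hx₀ : x₀ ∈ frontier Ω)
    (hreg : ∃ w, IsBarrier p ε Ω x₀ w) : lowerPerron p ε Ω g x₀ = g x₀ := by
  rw [lowerPerron_eq_neg hΩ hp, neg_eq_iff_eq_neg]
  exact upperPerron_eq_of_mem_frontier hΩ hp hg.neg hx₀ hreg

lemma exists_mem_SgUpper_lt (hp : 1 ≤ p) (hg : ContinuousOn g (frontier Ω))
    {x : EuclideanSpace ℝ (Fin N)} {c : ℝ} (h : upperPerron p ε Ω g x < c) :
    ∃ v ∈ SgUpper p ε Ω g, v x < c := by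
  obtain ⟨_, ⟨v, hv, rfl⟩, h'⟩ :=
    exists_lt_of_csInf_lt ((SgUpper_nonempty hΩ hp hg).image _) h
  exact ⟨v, hv, h'⟩

lemma upperPerron_le (hp : 1 ≤ p) (hNp : 2 ≤ N ∨ p ≠ 1) (hg : ContinuousOn g (frontier Ω))
    {v : EuclideanSpace ℝ (Fin N) → ℝ} (hv : v ∈ SgUpper p ε Ω g)
    {x : EuclideanSpace ℝ (Fin N)} (hx : x ∈ closure Ω) : upperPerron p ε Ω g x ≤ v x := by
  obtain ⟨C, hC⟩ := hΩ.isCompact_frontier.exists_bound_of_continuousOn hg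
  refine csInf_le ⟨-C, ?_⟩ ⟨v, hv, rfl⟩
  rintro _ ⟨w, hw, rfl⟩
  have := le_of_mem_SgLower hΩ hp hNp (neg_mem_SgLower hΩ hp hw) (L := C)
    (fun y hy => (neg_le_abs _).trans (hC y hy)) hx
  change -C ≤ w x
  linarith

lemma upperSemicontinuousOn_upperPerron (hp : 1 ≤ p) (hNp : 2 ≤ N ∨ p ≠ 1)
    (hg : ContinuousOn g (frontier Ω)) :
    UpperSemicontinuousOn (upperPerron p ε Ω g) (closure Ω) := by
  intro x hx c hc
  obtain ⟨v, hv, hvc⟩ := exists_mem_SgUpper_lt hΩ hp hg hc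
  filter_upwards [(hv.1 x hx).eventually_lt continuousWithinAt_const hvc, self_mem_nhdsWithin]
    with y hy hyΩ
  exact (upperPerron_le hΩ hp hNp hg hv hyΩ).trans_lt hy

lemma isClosed_superlevel_upperPerron (hp : 1 ≤ p) (hNp : 2 ≤ N ∨ p ≠ 1)
    (hg : ContinuousOn g (frontier Ω)) (c : ℝ) :
    IsClosed (closure Ω ∩ upperPerron p ε Ω g ⁻¹' Set.Ici c) :=
  isClosed_inter_preimage_Ici isClosed_closure
    (upperSemicontinuousOn_upperPerron hΩ hp hNp hg) c

/-- The upper Perron solution is the pointwise limit of a decreasing sequence of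
supersolutions. -/
lemma exists_antitone_tendsto_upperPerron (hp : 1 ≤ p) (hNp : 2 ≤ N ∨ p ≠ 1)
    (hg : ContinuousOn g (frontier Ω)) :
    ∃ w : ℕ → EuclideanSpace ℝ (Fin N) → ℝ, (∀ n, w n ∈ SgUpper p ε Ω g) ∧ Antitone w ∧
      ∀ x ∈ closure Ω, Tendsto (fun n => w n x) atTop (𝓝 (upperPerron p ε Ω g x)) := by
  have hT : ∀ q : ℚ, ∃ T : Set (SgUpper p ε Ω g), T.Countable ∧
      ⋃ v ∈ T, {x : closure Ω | v.1 x < q} = ⋃ v : SgUpper p ε Ω g, {x : closure Ω | v.1 x < q} := fun q =>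
    TopologicalSpace.isOpen_iUnion_countable _ fun v =>
      isOpen_lt (continuousOn_iff_continuous_domRestrict.1 v.2.1) continuous_const
  choose T hTc hT using hT
  obtain ⟨v₀, hv₀⟩ := SgUpper_nonempty hΩ hp hg
  obtain ⟨e, he⟩ := ((Set.countable_iUnion hTc).insert ⟨v₀, hv₀⟩).exists_eq_range
    (Set.insert_nonempty _ _)
  let w : ℕ → EuclideanSpace ℝ (Fin N) → ℝ := fun n =>
    Nat.rec (e 0).1 (fun k f x => min (f x) ((e (k + 1)).1 x)) n
  have hws : ∀ n, w (n + 1) = fun x => min (w n x) ((e (n + 1)).1 x) := fun n => rfl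
  have hw : ∀ n, w n ∈ SgUpper p ε Ω g := fun n => by
    induction n with
    | zero => exact (e 0).2
    | succ k ih => rw [hws]; exact min_mem_SgUpper hΩ hp ih (e (k + 1)).2
  have hanti : Antitone w := antitone_nat_of_succ_le fun n x => by
    rw [hws]; exact min_le_left _ _
  have hwe : ∀ n x, w n x ≤ (e n).1 x := fun n x => by
    cases n with
    | zero => exact le_rfl
    | succ k => rw [hws]; exact min_le_right _ _
  refine ⟨w, hw, hanti, fun x hx => ?_⟩
  refine tendsto_order.2 ⟨fun a ha => Eventually.of_forall fun n =>
    ha.trans_le (upperPerron_le hΩ hp hNp hg (hw n) hx), fun a ha => ?_⟩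
  obtain ⟨q, hq, hqa⟩ := exists_rat_btwn ha
  obtain ⟨v, hv, hvq⟩ := exists_mem_SgUpper_lt hΩ hp hg hq
  have hmem : (⟨x, hx⟩ : closure Ω) ∈ ⋃ v : SgUpper p ε Ω g, {x : closure Ω | v.1 x < q} :=
    Set.mem_iUnion.2 ⟨⟨v, hv⟩, hvq⟩
  rw [← hT q] at hmem
  obtain ⟨v', hv', hlt⟩ := Set.mem_iUnion₂.1 hmem
  have hlt : v'.1 x < q := hlt
  obtain ⟨k, hk⟩ : v' ∈ Set.range e := he ▸ Set.mem_insert_of_mem _ (Set.mem_iUnion.2 ⟨q, hv'⟩)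
  filter_upwards [eventually_ge_atTop k] with n hn
  have h1 : w n x ≤ w k x := hanti hn x
  have h2 := hwe k x
  rw [hk] at h2
  linarith

/-- The upper Perron solution is a subsolution in the integral sense, for finite `p`. -/
lemma integral_signedPow_upperPerron_nonneg (hp : 1 ≤ p) (hp' : p ≠ ⊤) (hNp : 2 ≤ N ∨ p ≠ 1)
    (hg : ContinuousOn g (frontier Ω)) {x : EuclideanSpace ℝ (Fin N)} (hx : x ∈ Ω) :
    0 ≤ ∫ y in ball x (rEps ε Ω x),
      signedPow p.toReal (upperPerron p ε Ω g y - upperPerron p ε Ω g x) := by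
  obtain ⟨w, hw, hanti, hlim⟩ := exists_antitone_tendsto_upperPerron hΩ hp hNp hg
  have hr := hΩ.rEps_pos hx
  have hcb := fun n => hΩ.continuousOn_closedBall hx (hw n).1
  obtain ⟨C, hC⟩ := exists_abs_le_of_continuousOn_closedBall (hcb 0)
  obtain ⟨C', hC'⟩ := hΩ.isCompact_frontier.exists_bound_of_continuousOn hg
  set U := upperPerron p ε Ω g
  have hsub : ∀ y ∈ ball x (rEps ε Ω x), y ∈ closure Ω := fun y hy =>
    subset_closure (hΩ.ball_rEps_subset hx hy)
  refine integral_signedPow_nonneg_of_tendsto (f := fun n y => w n y - U x)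
    (C := max C C' + |U x|) (one_le_toReal hp hp') (fun n =>
    (aemeasurable_restrict_ball (hcb n)).sub_const _) (fun n => ae_restrict_ball_of_forall
    fun y hy => ?_) (ae_restrict_ball_of_forall fun y hy n => ?_)
    (ae_restrict_ball_of_forall fun y hy => (hlim y (hsub y hy)).sub_const _) fun n => ?_
  · have h1 := hC y (ball_subset_closedBall hy)
    have h2 : w n y ≤ w 0 y := hanti (Nat.zero_le n) y
    have h3 := le_of_mem_SgLower hΩ hp hNp (neg_mem_SgLower hΩ hp (hw n)) (L := C')
      (fun y hy => (neg_le_abs _).trans (hC' y hy)) (hsub y hy)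
    refine (abs_sub _ _).trans (add_le_add (abs_le.2 ⟨?_, ?_⟩) le_rfl)
    · linarith [le_max_right C C']
    · linarith [le_max_left C C', le_abs_self (w 0 y)]
  · exact sub_le_sub_right (upperPerron_le hΩ hp hNp hg (hw n) (hsub y hy)) _
  · have h1 := upperPerron_le hΩ hp hNp hg (muEps_mem_SgUpper hΩ hp (hw n)) (subset_closure hx)
    rwa [muEps_of_mem hx, le_pMean_iff hp hp' hr (hcb n)] at h1

/-- The upper Perron solution is a subsolution for `p = ∞`. -/
lemma exists_upperPerron_le_midrange (hg : ContinuousOn g (frontier Ω))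
    {x : EuclideanSpace ℝ (Fin N)} (hx : x ∈ Ω) :
    ∃ y ∈ closedBall x (rEps ε Ω x), ∀ z ∈ closedBall x (rEps ε Ω x),
      upperPerron ⊤ ε Ω g x ≤ (upperPerron ⊤ ε Ω g y + upperPerron ⊤ ε Ω g z) / 2 := by
  have hNp : 2 ≤ N ∨ (⊤ : ℝ≥0∞) ≠ 1 := Or.inr (by simp)
  obtain ⟨w, hw, hanti, hlim⟩ := exists_antitone_tendsto_upperPerron hΩ le_top hNp hg
  have hr := hΩ.rEps_pos hx
  set B := closedBall x (rEps ε Ω x) with hB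
  set U := upperPerron ⊤ ε Ω g
  have hBΩ : B ⊆ closure Ω := hΩ.closedBall_rEps_subset hx
  obtain ⟨y, hy, hmax⟩ := UpperSemicontinuousOn.exists_isMaxOn
    (s := B) ⟨x, mem_closedBall_self hr.le⟩ (isCompact_closedBall x _)
    ((upperSemicontinuousOn_upperPerron hΩ le_top hNp hg).mono hBΩ)
  refine ⟨y, hy, fun z hz => le_of_forall_pos_le_add fun η hη => ?_⟩
  obtain ⟨k, hk⟩ : ∃ k, B ∩ w k ⁻¹' Set.Ici (U y + η) = ∅ := by
    by_contra! h
    have hcl : ∀ n, IsClosed (B ∩ w n ⁻¹' Set.Ici (U y + η)) := fun n =>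
      ((hw n).1.mono hBΩ).preimage_isClosed_of_isClosed isClosed_closedBall isClosed_Ici
    obtain ⟨a, ha⟩ := IsCompact.nonempty_iInter_of_sequence_nonempty_isCompact_isClosed
      (fun n => B ∩ w n ⁻¹' Set.Ici (U y + η))
      (fun n b hb => ⟨hb.1, le_trans (α := ℝ) hb.2 (hanti n.le_succ b)⟩) h
      ((isCompact_closedBall x _).of_isClosed_subset (hcl 0) Set.inter_subset_left) hcl
    rw [Set.mem_iInter] at ha
    have h1 := ge_of_tendsto' (hlim a (hBΩ (ha 0).1)) fun n => (ha n).2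
    have h2 : U a ≤ U y := hmax (ha 0).1
    linarith
  have h1 : ∀ n ≥ k, U x ≤ (U y + η + w n z) / 2 := by
    intro n hn
    have h2 := upperPerron_le hΩ le_top hNp hg (muEps_mem_SgUpper hΩ le_top (hw n))
      (subset_closure hx)
    obtain ⟨a, ha, b, hb, hab, e⟩ :=
      exists_pMean_top_eq hr (hΩ.continuousOn_closedBall hx (hw n).1)
    rw [muEps_of_mem hx, e] at h2
    have h3 : w k a < U y + η := by
      by_contra! h
      exact Set.notMem_empty a (hk ▸ ⟨ha, h⟩)
    have h4 : w n a ≤ w k a := hanti hn a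
    have h5 := (hab z hz).1
    change U x ≤ _ at h2
    linarith
  have h2 := ge_of_tendsto ((((hlim z (hBΩ hz)).const_add (U y + η)).div_const 2))
    (eventually_atTop.2 ⟨k, h1⟩)
  linarith

/-- Where the upper Perron solution lies below a level, its superlevel set fills at most half of
the ball, for `p = 1`. -/
lemma volume_superlevel_le_of_upperPerron_lt (hN : 2 ≤ N) (hg : ContinuousOn g (frontier Ω))
    {x : EuclideanSpace ℝ (Fin N)} (hx : x ∈ Ω) {m : ℝ} (hm : upperPerron 1 ε Ω g x < m) :
    2 * volume (ball x (rEps ε Ω x) ∩ (closure Ω ∩ upperPerron 1 ε Ω g ⁻¹' Set.Ici m)) ≤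
      volume (ball x (rEps ε Ω x)) := by
  obtain ⟨v, hv, hvm⟩ := exists_mem_SgUpper_lt hΩ le_rfl hg hm
  have hr := hΩ.rEps_pos hx
  have hcl := hv.1.preimage_isClosed_of_isClosed isClosed_closure (isClosed_Ici (a := m))
  have h1 := (hv.2.1 x hx).trans_lt hvm
  rw [muEps_of_mem hx, ← not_le, le_pMean_iff le_rfl (by simp) hr
    (hΩ.continuousOn_closedBall hx hv.1), ENNReal.toReal_one,
    integral_signedPow_one_nonneg_iff hcl.measurableSet, not_le] at h1
  · refine le_trans ?_ h1.le
    refine mul_le_mul' le_rfl (measure_mono fun y hy => ⟨hy.1, hy.2.1, ?_⟩)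
    exact le_trans (α := ℝ) hy.2.2 (upperPerron_le hΩ le_rfl (Or.inl hN) hg hv hy.2.1)
  · exact fun z hz => ⟨fun h => h.2, fun h => ⟨subset_closure (hΩ.ball_rEps_subset hx hz), h⟩⟩

end Perron

section Comparison

variable {N : ℕ} {p : ℝ≥0∞} {Ω : Set (EuclideanSpace ℝ (Fin N))} {ε : ℝ}
  {g : EuclideanSpace ℝ (Fin N) → ℝ} (hΩ : AdmissibleDomain Ω ε)

include hΩ

lemma exists_abs_upperPerron_le (hp : 1 ≤ p) (hNp : 2 ≤ N ∨ p ≠ 1)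
    (hg : ContinuousOn g (frontier Ω)) :
    ∃ C, ∀ x ∈ closure Ω, |upperPerron p ε Ω g x| ≤ C := by
  obtain ⟨C, hC⟩ := hΩ.isCompact_frontier.exists_bound_of_continuousOn hg
  refine ⟨C, fun x hx => abs_le.2 ⟨?_, ?_⟩⟩
  · refine le_csInf ((SgUpper_nonempty hΩ hp hg).image _) ?_
    rintro _ ⟨w, hw, rfl⟩
    have := le_of_mem_SgLower hΩ hp hNp (neg_mem_SgLower hΩ hp hw) (L := C)
      (fun y hy => (neg_le_abs _).trans (hC y hy)) hx
    change -C ≤ w x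
    linarith
  · exact upperPerron_le hΩ hp hNp hg (v := fun _ => C) ⟨continuousOn_const,
      fun x hx => (muEps_const hΩ hp C hx).le, fun x hx => (le_abs_self _).trans (hC x hx)⟩ hx

lemma integrable_signedPow_upperPerron (hp : 1 ≤ p) (hp' : p ≠ ⊤) (hNp : 2 ≤ N ∨ p ≠ 1)
    (hg : ContinuousOn g (frontier Ω)) {x : EuclideanSpace ℝ (Fin N)} (hx : x ∈ Ω) (t : ℝ) :
    Integrable (fun y => signedPow p.toReal (upperPerron p ε Ω g y - t))
      (volume.restrict (ball x (rEps ε Ω x))) := by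
  obtain ⟨C, hC⟩ := exists_abs_upperPerron_le hΩ hp hNp hg
  obtain ⟨w, hw, -, hlim⟩ := exists_antitone_tendsto_upperPerron hΩ hp hNp hg
  have hsub : ∀ y ∈ ball x (rEps ε Ω x), y ∈ closure Ω := fun y hy =>
    subset_closure (hΩ.ball_rEps_subset hx hy)
  refine integrable_signedPow (one_le_toReal hp hp') ?_
    (ae_restrict_ball_of_forall fun y hy => hC y (hsub y hy)) t
  exact aemeasurable_of_tendsto_metrizable_ae atTop
    (fun n => aemeasurable_restrict_ball (hΩ.continuousOn_closedBall hx (hw n).1))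
    (ae_restrict_ball_of_forall fun y hy => hlim y (hsub y hy))

lemma upperPerron_add_upperPerron_neg_nonpos (hp : 1 ≤ p) (hp1 : p ≠ 1)
    (hg : ContinuousOn g (frontier Ω)) (hreg : ∀ x₀ ∈ frontier Ω, ∃ w, IsBarrier p ε Ω x₀ w)
    {x : EuclideanSpace ℝ (Fin N)} (hx : x ∈ closure Ω) :
    upperPerron p ε Ω g x + upperPerron p ε Ω (fun y => -g y) x ≤ 0 := by
  have hNp : 2 ≤ N ∨ p ≠ 1 := Or.inr hp1
  set U := upperPerron p ε Ω g with hU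
  set V := upperPerron p ε Ω (fun y => -g y) with hV
  have hUusc := upperSemicontinuousOn_upperPerron hΩ hp hNp hg
  have hVusc := upperSemicontinuousOn_upperPerron hΩ hp hNp hg.neg
  have husc : UpperSemicontinuousOn (fun x => U x + V x) (closure Ω) := hUusc.add hVusc
  obtain ⟨a, ha, hmax⟩ := husc.exists_isMaxOn hΩ.nonempty.closure hΩ.isCompact_closure
  have hmax : ∀ y ∈ closure Ω, U y + V y ≤ U a + V a := fun y hy => hmax hy
  refine (hmax x hx).trans ?_
  by_contra! hD
  set D := U a + V a
  set K := closure Ω ∩ (fun x => U x + V x) ⁻¹' Set.Ici D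
  have hKcl : IsClosed K := isClosed_inter_preimage_Ici isClosed_closure husc D
  have hK : IsCompact K := hΩ.isCompact_closure.of_isClosed_subset hKcl Set.inter_subset_left
  have hKΩ : K ⊆ Ω := fun y hy => (hΩ.mem_or_mem_frontier hy.1).resolve_right fun h => by
    have h1 : U y = g y := upperPerron_eq_of_mem_frontier hΩ hp hg h (hreg y h)
    have h2 : V y = -g y := upperPerron_eq_of_mem_frontier hΩ hp hg.neg h (hreg y h)
    have h3 : D ≤ U y + V y := hy.2
    linarith
  have hKne : K.Nonempty := ⟨a, ha, le_refl D⟩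
  have hKeq : ∀ y ∈ K, U y + V y = D := fun y hy => le_antisymm (hmax y hy.1) hy.2
  rcases ne_top_one_or_one_lt hp with rfl | rfl | ⟨hp', hq⟩
  · obtain ⟨b, hb, hbmax⟩ :=
      (hUusc.mono Set.inter_subset_left).exists_isMaxOn (s := K) hKne hK
    have hbmax : ∀ y ∈ K, U y ≤ U b := fun y hy => hbmax hy
    set K' := K ∩ U ⁻¹' Set.Ici (U b)
    have hK'cl : IsClosed K' :=
      isClosed_inter_preimage_Ici hKcl (hUusc.mono Set.inter_subset_left) _
    have hK' : IsCompact K' := hK.of_isClosed_subset hK'cl Set.inter_subset_left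
    refine Set.Nonempty.ne_empty (s := K') ⟨b, hb, le_refl (U b)⟩
      (eq_empty_of_ball_subset hΩ.dim_pos hK' fun z hz => ?_)
    have hzΩ := hKΩ hz.1
    have hzb : U z = U b := le_antisymm (hbmax z hz.1) hz.2
    have hzD := hKeq z hz.1
    refine ⟨_, hΩ.rEps_pos hzΩ, fun y hy => ?_⟩
    have hsub := hΩ.closedBall_rEps_subset hzΩ
    obtain ⟨c, hc, hcU⟩ := exists_upperPerron_le_midrange hΩ hg hzΩ
    obtain ⟨d, hd, hdV⟩ := exists_upperPerron_le_midrange hΩ hg.neg hzΩ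
    have hyB := ball_subset_closedBall hy
    have h1 : U z ≤ (U c + U d) / 2 := hcU d hd
    have h2 : V z ≤ (V d + V c) / 2 := hdV c hc
    have h3 := hmax c (hsub hc)
    have h4 := hmax d (hsub hd)
    have hcK : c ∈ K := ⟨hsub hc, show D ≤ U c + V c by linarith⟩
    have hdK : d ∈ K := ⟨hsub hd, show D ≤ U d + V d by linarith⟩
    have h5 := hbmax c hcK
    have h6 := hbmax d hdK
    have h7 : U z ≤ (U c + U y) / 2 := hcU y hyB
    have h8 : V z ≤ (V d + V y) / 2 := hdV y hyB
    have h9 := hKeq d hdK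
    exact ⟨⟨hsub hyB, show D ≤ U y + V y by linarith⟩, show U b ≤ U y by linarith⟩
  · exact hp1 rfl
  · refine hKne.ne_empty (eq_empty_of_ball_subset hΩ.dim_pos hK fun z hz =>
      ⟨_, hΩ.rEps_pos (hKΩ hz), ball_subset_of_ae hKcl ?_⟩)
    have hzD := hKeq z hz
    have hsub : ∀ y ∈ ball z (rEps ε Ω z), y ∈ closure Ω := fun y hy =>
      subset_closure (hΩ.ball_rEps_subset (hKΩ hz) hy)
    have h1 := integral_signedPow_upperPerron_nonneg hΩ hp hp' hNp hg (hKΩ hz)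
    have h2 := integral_signedPow_upperPerron_nonneg hΩ hp hp' hNp hg.neg (hKΩ hz)
    have i1 := integrable_signedPow_upperPerron hΩ hp hp' hNp hg (hKΩ hz) (U z)
    have i2 := integrable_signedPow_upperPerron hΩ hp hp' hNp hg.neg (hKΩ hz) (V z)
    have hodd := signedPow_neg hq
    have hinj := (signedPow_strictMono hq).injective
    have hmono := signedPow_mono hq.le
    set ψ := signedPow p.toReal
    change Integrable (fun y => ψ (U y - U z)) _ at i1
    change Integrable (fun y => ψ (V y - V z)) _ at i2
    have hneg : 0 ≤ᵐ[volume.restrict (ball z (rEps ε Ω z))]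
        fun y => -(ψ (U y - U z) + ψ (V y - V z)) := by
      refine ae_restrict_ball_of_forall fun y hy => ?_
      have h3 := hmax y (hsub y hy)
      have h4 : ψ (U y - U z) ≤ ψ (-(V y - V z)) := hmono (by linarith)
      rw [hodd] at h4
      change 0 ≤ -(ψ (U y - U z) + ψ (V y - V z))
      linarith
    have h0 : ∫ y in ball z (rEps ε Ω z), -(ψ (U y - U z) + ψ (V y - V z)) = 0 := by
      refine le_antisymm ?_ (integral_nonneg_of_ae hneg)
      rw [integral_neg, integral_add i1 i2]
      exact neg_nonpos.2 (add_nonneg h1 h2)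
    rw [integral_eq_zero_iff_of_nonneg_ae hneg (i1.add i2).neg] at h0
    filter_upwards [h0, ae_restrict_mem measurableSet_ball] with y hy hyb
    refine ⟨hsub y hyb, ?_⟩
    have h3 : ψ (U y - U z) = ψ (-(V y - V z)) := by
      rw [hodd]
      have : -(ψ (U y - U z) + ψ (V y - V z)) = 0 := hy
      linarith
    have h4 := hinj h3
    change D ≤ U y + V y
    linarith

end Comparison

section MedianComparison

lemma tendsto_volume_real_ball {N : ℕ} (hN : 0 < N) (x : EuclideanSpace ℝ (Fin N)) {r : ℝ}
    (hr : 0 < r) {s : ℝ → ℝ} (hs : Tendsto s (𝓝[>] 0) (𝓝 r)) :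
    Tendsto (fun δ => volume.real (ball x (s δ))) (𝓝[>] 0) (𝓝 (volume.real (ball x r))) := by
  have : Nonempty (Fin N) := ⟨⟨0, hN⟩⟩
  have e : ∀ t : ℝ, 0 ≤ t → volume.real (ball x t) =
      t ^ N * volume.real (ball (0 : EuclideanSpace ℝ (Fin N)) 1) := fun t ht => by
    rw [Measure.real, Measure.addHaar_ball volume x ht, ENNReal.toReal_mul,
      ENNReal.toReal_ofReal (by positivity), finrank_euclideanSpace_fin, Measure.real]
  rw [e r hr.le]
  refine ((hs.pow N).mul_const _).congr' ?_
  filter_upwards [hs.eventually (lt_mem_nhds hr)] with δ hδ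
  exact (e _ hδ.le).symm

variable {N : ℕ} {Ω : Set (EuclideanSpace ℝ (Fin N))} {ε : ℝ}
  {g : EuclideanSpace ℝ (Fin N) → ℝ} (hΩ : AdmissibleDomain Ω ε)

include hΩ

/-- The half-volume bound for superlevel sets passes to limits of points lying below the level. -/
lemma volume_superlevel_le_of_mem_closure (hN : 2 ≤ N) (hg : ContinuousOn g (frontier Ω))
    {x : EuclideanSpace ℝ (Fin N)} (hx : x ∈ Ω) {m : ℝ}
    (hm : x ∈ closure (closure Ω \ (closure Ω ∩ upperPerron 1 ε Ω g ⁻¹' Set.Ici m))) :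
    2 * volume (ball x (rEps ε Ω x) ∩ (closure Ω ∩ upperPerron 1 ε Ω g ⁻¹' Set.Ici m)) ≤
      volume (ball x (rEps ε Ω x)) := by
  have hE := isClosed_superlevel_upperPerron hΩ le_rfl (Or.inl hN) hg m
  set E := closure Ω ∩ upperPerron 1 ε Ω g ⁻¹' Set.Ici m with hEdef
  set r := rEps ε Ω x with hrdef
  have hr : 0 < r := hΩ.rEps_pos hx
  have hfin : ∀ s, volume (ball x s) ≠ ⊤ := fun s => measure_ball_lt_top.ne
  have hfin' : ∀ s, volume (ball x s ∩ E) ≠ ⊤ := fun s =>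
    ((measure_mono Set.inter_subset_left).trans_lt measure_ball_lt_top).ne
  have hreal : 2 * volume.real (ball x r ∩ E) ≤ volume.real (ball x r) := by
    have hlim : Tendsto (fun δ => volume.real (ball x (r + 2 * δ)) + 2 * volume.real (ball x r) -
        2 * volume.real (ball x (r - 2 * δ))) (𝓝[>] 0) (𝓝 (volume.real (ball x r))) := by
      have h1 : Tendsto (fun δ : ℝ => r + 2 * δ) (𝓝[>] 0) (𝓝 r) := by
        have : Tendsto (fun δ : ℝ => r + 2 * δ) (𝓝 0) (𝓝 (r + 2 * 0)) :=
          Continuous.tendsto (by fun_prop) 0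
        rw [mul_zero, add_zero] at this
        exact this.mono_left nhdsWithin_le_nhds
      have h2 : Tendsto (fun δ : ℝ => r - 2 * δ) (𝓝[>] 0) (𝓝 r) := by
        have : Tendsto (fun δ : ℝ => r - 2 * δ) (𝓝 0) (𝓝 (r - 2 * 0)) :=
          Continuous.tendsto (by fun_prop) 0
        rw [mul_zero, sub_zero] at this
        exact this.mono_left nhdsWithin_le_nhds
      have h3 := ((tendsto_volume_real_ball hΩ.dim_pos x hr h1).add_const
        (2 * volume.real (ball x r))).sub
        ((tendsto_volume_real_ball hΩ.dim_pos x hr h2).const_mul 2)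
      convert h3 using 2
      ring
    refine ge_of_tendsto hlim ?_
    filter_upwards [self_mem_nhdsWithin] with δ (hδ : 0 < δ)
    obtain ⟨y, ⟨hyd, hyΩ⟩, hyc, hyE⟩ := _root_.mem_closure_iff.1 hm (ball x δ ∩ Ω)
      (isOpen_ball.inter hΩ.isOpen) ⟨mem_ball_self hδ, hx⟩
    have hlt : upperPerron 1 ε Ω g y < m := by
      by_contra! h
      exact hyE ⟨hyc, h⟩
    have h1 := volume_superlevel_le_of_upperPerron_lt hΩ hN hg hyΩ hlt
    have h2 := abs_le.1 (AdmissibleDomain.abs_rEps_sub_le (ε := ε) (Ω := Ω) y x)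
    rw [mem_ball] at hyd
    have h3 : ball x (r - 2 * δ) ⊆ ball y (rEps ε Ω y) :=
      ball_subset_ball' (by rw [dist_comm]; linarith [h2.1])
    have h4 : ball y (rEps ε Ω y) ⊆ ball x (r + 2 * δ) :=
      ball_subset_ball' (by linarith [h2.2])
    have h5 : 2 * volume (ball x (r - 2 * δ) ∩ E) ≤ volume (ball x (r + 2 * δ)) :=
      (mul_le_mul' le_rfl (measure_mono (Set.inter_subset_inter_left _ h3))).trans
        (h1.trans (measure_mono h4))
    rw [← ENNReal.toReal_le_toReal (ENNReal.mul_ne_top (by simp) (hfin' _)) (hfin _),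
      ENNReal.toReal_mul] at h5
    have h5 : 2 * volume.real (ball x (r - 2 * δ) ∩ E) ≤ volume.real (ball x (r + 2 * δ)) := h5
    have h6 : volume.real (ball x r \ ball x (r - 2 * δ)) =
        volume.real (ball x r) - volume.real (ball x (r - 2 * δ)) :=
      measureReal_sdiff (ball_subset_ball (by linarith)) measurableSet_ball (hfin _)
    have h7 : volume.real (ball x r ∩ E) ≤ volume.real (ball x (r - 2 * δ) ∩ E) +
        volume.real (ball x r \ ball x (r - 2 * δ)) := by
      refine (measureReal_mono ?_ ?_).trans (measureReal_union_le _ _)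
      · rintro z ⟨hz, hzE⟩
        by_cases h : z ∈ ball x (r - 2 * δ)
        · exact Or.inl ⟨h, hzE⟩
        · exact Or.inr ⟨hz, h⟩
      · exact measure_union_ne_top (hfin' _) (measure_ne_top_of_subset Set.sdiff_subset (hfin r))
    linarith
  rw [← ENNReal.toReal_le_toReal (ENNReal.mul_ne_top (by simp) (hfin' r)) (hfin r),
    ENNReal.toReal_mul]
  exact hreal

end MedianComparison

/-- Two nested closed sets filling exactly half of some ball around each point where the smaller
one touches the complement of the larger one have no such point, in dimension at least two. -/
lemma inter_closure_sdiff_eq_empty {N : ℕ} (hN : 2 ≤ N)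
    {X E E' : Set (EuclideanSpace ℝ (Fin N))} (hE : IsClosed E) (hE' : IsClosed E')
    (hsub : E' ⊆ E) (hT : IsCompact (E' ∩ closure (X \ E)))
    (h : ∀ x ∈ E' ∩ closure (X \ E), ∃ r > 0, ball x r ⊆ X ∧
      volume (ball x r) ≤ 2 * volume (ball x r ∩ E') ∧
      2 * volume (ball x r ∩ E) ≤ volume (ball x r)) : E' ∩ closure (X \ E) = ∅ := by
  set T := E' ∩ closure (X \ E) with hTdef
  by_contra hne
  obtain ⟨x, hx, e, f, he, -, hef, hmax, hf⟩ :=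
    exists_extremal hN hT (Set.nonempty_iff_ne_empty.2 hne)
  obtain ⟨r, hr, hBX, hvol', hvol⟩ := h x hx
  obtain ⟨t, ht, hy⟩ := eventually_add_smul_mem_ball x f hr
  have hye : inner ℝ e (x + t • f - x) = 0 := by
    rw [add_sub_cancel_left, real_inner_smul_right, hef, mul_zero]
  have hye' : inner ℝ (-e) (x + t • f - x) = 0 := by rw [inner_neg_left, hye, neg_zero]
  have hcl : closure (ball x r \ E) ⊆ closure (X \ E) :=
    closure_mono (Set.sdiff_subset_sdiff_left hBX)
  have hnull : volume (ball x r ∩ (E \ E')) = 0 := by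
    have h1 : volume (ball x r ∩ E) ≤ volume (ball x r ∩ E') :=
      (ENNReal.mul_le_mul_iff_right (by simp) (by simp)).1 (hvol.trans hvol')
    have hfin : volume (ball x r ∩ E') ≠ ⊤ :=
      ((measure_mono Set.inter_subset_left).trans_lt measure_ball_lt_top).ne
    have h2 : ball x r ∩ (E \ E') = (ball x r ∩ E) \ (ball x r ∩ E') := by
      ext z
      simp only [Set.mem_inter_iff, Set.mem_sdiff]
      tauto
    rw [h2, measure_sdiff (Set.inter_subset_inter_right _ hsub)
      (measurableSet_ball.inter hE'.measurableSet).nullMeasurableSet hfin, tsub_eq_zero_iff_le]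
    exact h1
  have hHT : Disjoint (halfBall e x r) T :=
    Set.disjoint_left.2 fun z hz hz' => not_lt.2 (hmax z hz') hz.2
  have hinter : halfBall e x r ∩ E' ⊆ interior E' := by
    rintro z ⟨hz, hzE'⟩
    have hz' : z ∉ closure (X \ E) := fun h' => Set.disjoint_left.1 hHT hz ⟨hzE', h'⟩
    have hopen : IsOpen (ball x r ∩ (closure (X \ E))ᶜ) :=
      isOpen_ball.inter isClosed_closure.isOpen_compl
    have hempty : (ball x r ∩ (closure (X \ E))ᶜ) \ E' = ∅ := by
      refine ((hopen.sdiff hE').measure_eq_zero_iff volume).1 (measure_mono_null ?_ hnull)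
      rintro a ⟨⟨ha, ha'⟩, haE'⟩
      refine ⟨ha, ?_, haE'⟩
      by_contra haE
      exact ha' (subset_closure ⟨hBX ha, haE⟩)
    exact mem_interior.2 ⟨_, Set.sdiff_eq_empty.1 hempty, hopen, hz.1, hz'⟩
  have hconn : halfBall e x r ⊆ interior E' ∨ halfBall e x r ⊆ E'ᶜ := by
    refine isPreconnected_iff_subset_of_disjoint.1 convex_halfBall.isPreconnected _ _
      isOpen_interior hE'.isOpen_compl (fun z hz => ?_) ?_
    · by_cases hzE' : z ∈ E'
      · exact Or.inl (hinter ⟨hz, hzE'⟩)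
      · exact Or.inr hzE'
    · refine Set.eq_empty_of_forall_notMem fun z hz => hz.2.2 (interior_subset hz.2.1)
  rcases hconn with hH | hH
  · have hHE' := hH.trans interior_subset
    refine hf t ht ⟨closure_minimal hHE' hE' (mem_closure_halfBall he hy hye), hcl ?_⟩
    exact mem_closure_diff_of_volume he hE hvol (hHE'.trans hsub) hy hye
  · have hL := halfBall_subset_of_volume he hE' hvol'
      (Set.disjoint_left.2 fun z hz hz' => hH hz hz')
    refine hf t ht ⟨closure_minimal hL hE'
      (mem_closure_halfBall (neg_ne_zero.2 he) hy hye'), hcl ?_⟩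
    exact mem_closure_diff_of_volume (neg_ne_zero.2 he) hE hvol (hL.trans hsub) hy hye'

section MedianPerron

variable {N : ℕ} {Ω : Set (EuclideanSpace ℝ (Fin N))} {ε : ℝ}
  {g : EuclideanSpace ℝ (Fin N) → ℝ} (hΩ : AdmissibleDomain Ω ε)

include hΩ

lemma continuousOn_upperPerron_one (hN : 2 ≤ N) (hg : ContinuousOn g (frontier Ω))
    (hreg : ∀ x₀ ∈ frontier Ω, ∃ w, IsBarrier 1 ε Ω x₀ w)
    (hle : ∀ x ∈ closure Ω, lowerPerron 1 ε Ω g x ≤ upperPerron 1 ε Ω g x) :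
    ContinuousOn (upperPerron 1 ε Ω g) (closure Ω) := by
  have hUusc := upperSemicontinuousOn_upperPerron hΩ le_rfl (Or.inl hN) hg
  have hVusc := upperSemicontinuousOn_upperPerron hΩ le_rfl (Or.inl hN) hg.neg
  have hcl := isClosed_superlevel_upperPerron hΩ le_rfl (Or.inl hN) hg
  have hUg : ∀ x ∈ frontier Ω, upperPerron 1 ε Ω g x = g x := fun x hx =>
    upperPerron_eq_of_mem_frontier hΩ le_rfl hg hx (hreg x hx)
  have hVg : ∀ x ∈ frontier Ω, upperPerron 1 ε Ω (-g) x = -g x := fun x hx =>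
    upperPerron_eq_of_mem_frontier hΩ le_rfl hg.neg hx (hreg x hx)
  have hVU : ∀ x ∈ closure Ω, -upperPerron 1 ε Ω (-g) x ≤ upperPerron 1 ε Ω g x := fun x hx => by
    have := hle x hx
    rwa [lowerPerron_eq_neg hΩ le_rfl] at this
  have hpos := fun {x} (hx : x ∈ Ω) =>
    integral_signedPow_upperPerron_nonneg hΩ le_rfl (by simp) (Or.inl hN) hg hx
  have hvol := fun {x} (hx : x ∈ Ω) {m} =>
    volume_superlevel_le_of_mem_closure hΩ hN hg hx (m := m)
  set U := upperPerron 1 ε Ω g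
  refine continuousOn_iff_lower_upperSemicontinuousOn.2 ⟨fun x hx c hc => ?_, hUusc⟩
  obtain ⟨m, hcm, hmx⟩ := exists_between hc
  have hTΩ : ∀ y ∈ (closure Ω ∩ U ⁻¹' Set.Ici (U x)) ∩
      closure (closure Ω \ (closure Ω ∩ U ⁻¹' Set.Ici m)), y ∈ Ω := by
    rintro y ⟨⟨hyΩ, hyU⟩, hy⟩
    refine (hΩ.mem_or_mem_frontier hyΩ).resolve_right fun hyΓ => ?_
    have h1 : U x ≤ U y := hyU
    have h2 : upperPerron 1 ε Ω (-g) y < -m := by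
      rw [hVg y hyΓ, ← hUg y hyΓ]
      linarith
    have h3 := hVusc y hyΩ _ h2
    rw [eventually_nhdsWithin_iff] at h3
    obtain ⟨z, ⟨hz, hz'⟩, hz''⟩ := ((mem_closure_iff_frequently.1 hy).and_eventually h3).exists
    have h4 := hVU z hz
    have h5 := hz'' hz
    exact hz' ⟨hz, show m ≤ U z by linarith⟩
  have hT := inter_closure_sdiff_eq_empty (X := closure Ω) hN (hcl m) (hcl (U x))
    (fun y hy => ⟨hy.1, hmx.le.trans (α := ℝ) hy.2⟩)
    (hΩ.isCompact_closure.of_isClosed_subset ((hcl _).inter isClosed_closure)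
      (Set.inter_subset_left.trans Set.inter_subset_left)) fun y hy => by
    have hyΩ := hTΩ y hy
    have hsub := (hΩ.ball_rEps_subset hyΩ).trans subset_closure
    refine ⟨_, hΩ.rEps_pos hyΩ, hsub, ?_, hvol hyΩ hy.2⟩
    have h1 := hpos hyΩ
    rw [ENNReal.toReal_one, integral_signedPow_one_nonneg_iff (hcl (U y)).measurableSet] at h1
    · refine h1.trans (mul_le_mul' le_rfl (measure_mono fun z hz => ⟨hz.1, hz.2.1, ?_⟩))
      exact le_trans (α := ℝ) hy.1.2 hz.2.2
    · exact fun z hz => ⟨fun h => h.2, fun h => ⟨hsub hz, h⟩⟩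
  have hx' : x ∉ closure (closure Ω \ (closure Ω ∩ U ⁻¹' Set.Ici m)) := fun h =>
    Set.notMem_empty x (hT ▸ ⟨⟨hx, le_refl (U x)⟩, h⟩)
  rw [eventually_nhdsWithin_iff]
  filter_upwards [isClosed_closure.isOpen_compl.mem_nhds hx'] with y hy hyΩ
  by_contra! h
  refine hy (subset_closure ⟨hyΩ, fun h' => ?_⟩)
  have h'' : m ≤ U y := h'.2
  linarith

lemma upperPerron_one_le_lowerPerron (hN : 2 ≤ N) (hg : ContinuousOn g (frontier Ω))
    (hreg : ∀ x₀ ∈ frontier Ω, ∃ w, IsBarrier 1 ε Ω x₀ w)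
    (hle : ∀ x ∈ closure Ω, lowerPerron 1 ε Ω g x ≤ upperPerron 1 ε Ω g x)
    {x : EuclideanSpace ℝ (Fin N)} (hx : x ∈ closure Ω) :
    upperPerron 1 ε Ω g x ≤ lowerPerron 1 ε Ω g x := by
  have hcont := continuousOn_upperPerron_one hΩ hN hg hreg hle
  have hmem : upperPerron 1 ε Ω g ∈ SgLower 1 ε Ω g := by
    refine ⟨hcont, fun y hy => ?_, fun y hy =>
      (upperPerron_eq_of_mem_frontier hΩ le_rfl hg hy (hreg y hy)).le⟩
    rw [muEps_of_mem hy, le_pMean_iff le_rfl (by simp) (hΩ.rEps_pos hy)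
      (hΩ.continuousOn_closedBall hy hcont)]
    exact integral_signedPow_upperPerron_nonneg hΩ le_rfl (by simp) (Or.inl hN) hg hy
  rw [lowerPerron_eq_neg hΩ le_rfl]
  exact le_neg.1 (upperPerron_le hΩ le_rfl (Or.inl hN) hg.neg (neg_mem_SgUpper hΩ le_rfl hmem) hx)

end MedianPerron

section DimensionOne

lemma exists_eq_Ioo {S : Set ℝ} (hS : IsOpen S) (hc : IsConnected S)
    (hb : Bornology.IsBounded S) : ∃ a b : ℝ, S = Set.Ioo a b := by
  refine ⟨sInf S, sSup S, Set.Subset.antisymm ?_ (hc.Ioo_csInf_csSup_subset hb.bddBelow hb.bddAbove)⟩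
  rw [← interior_Icc]
  exact interior_maximal
    (fun x hx => ⟨csInf_le hb.bddBelow hx, le_csSup hb.bddAbove hx⟩) hS

lemma measurePreserving_apply_zero :
    MeasurePreserving (fun y : EuclideanSpace ℝ (Fin 1) => y 0) :=
  (volume_preserving_funUnique (Fin 1) ℝ).comp
    (PiLp.volume_preserving_ofLp (Fin 1))

lemma dist_eq_abs_apply_zero (x y : EuclideanSpace ℝ (Fin 1)) : dist x y = |x 0 - y 0| := by
  rw [EuclideanSpace.dist_eq]
  simp [Real.dist_eq, Real.sqrt_sq_eq_abs]

lemma ball_eq_preimage_apply_zero (x : EuclideanSpace ℝ (Fin 1)) (r : ℝ) :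
    ball x r = (fun y : EuclideanSpace ℝ (Fin 1) => y 0) ⁻¹' Set.Ioo (x 0 - r) (x 0 + r) := by
  ext y
  rw [mem_ball, dist_eq_abs_apply_zero, Set.mem_preimage, Set.mem_Ioo, abs_lt]
  constructor <;> rintro ⟨h1, h2⟩ <;> constructor <;> linarith

variable {Ω : Set (EuclideanSpace ℝ (Fin 1))} {ε : ℝ} {g : EuclideanSpace ℝ (Fin 1) → ℝ}

lemma exists_eq_preimage_Ioo (hΩ : AdmissibleDomain Ω ε) (hc : IsPreconnected Ω) :
    ∃ a b : ℝ, a < b ∧ Ω = (fun y : EuclideanSpace ℝ (Fin 1) => y 0) ⁻¹' Set.Ioo a b := by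
  have hcont : Continuous fun y : EuclideanSpace ℝ (Fin 1) => y 0 := by fun_prop
  have hinv : Continuous fun t : ℝ => EuclideanSpace.single (0 : Fin 1) t :=
    (Isometry.of_dist_eq fun s t => by simp [Real.dist_eq]).continuous
  have hleft : ∀ y : EuclideanSpace ℝ (Fin 1), EuclideanSpace.single (0 : Fin 1) (y 0) = y :=
    fun y => by
      ext i
      fin_cases i
      simp
  set S := (fun t : ℝ => EuclideanSpace.single (0 : Fin 1) t) ⁻¹' Ω with hSdef
  have hSimg : S = (fun y : EuclideanSpace ℝ (Fin 1) => y 0) '' Ω := by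
    ext t
    constructor
    · intro ht
      exact ⟨_, ht, by simp⟩
    · rintro ⟨y, hy, rfl⟩
      change EuclideanSpace.single (0 : Fin 1) (y 0) ∈ Ω
      rwa [hleft]
  have hbdd : Bornology.IsBounded S := by
    have : IsCompact ((fun y : EuclideanSpace ℝ (Fin 1) => y 0) '' closure Ω) :=
      hΩ.isCompact_closure.image hcont
    rw [hSimg]
    exact this.isBounded.subset (Set.image_mono subset_closure)
  have hSc : IsConnected S := by
    rw [hSimg]
    exact IsConnected.image ⟨hΩ.nonempty, hc⟩ _ hcont.continuousOn
  obtain ⟨a, b, hab⟩ := exists_eq_Ioo (hΩ.isOpen.preimage hinv) hSc hbdd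
  have hΩeq : Ω = (fun y : EuclideanSpace ℝ (Fin 1) => y 0) ⁻¹' Set.Ioo a b := by
    rw [← hab]
    ext y
    change y ∈ Ω ↔ EuclideanSpace.single (0 : Fin 1) (y 0) ∈ Ω
    rw [hleft]
  refine ⟨a, b, ?_, hΩeq⟩
  obtain ⟨y, hy⟩ := hΩ.nonempty
  rw [hΩeq] at hy
  exact hy.1.trans hy.2

/-- Every interval of length at least `r` containing the centre of an interval of length `2 * r`
fills at least half of it. -/
lemma volume_ball_le_two_mul_of_subset {x : EuclideanSpace ℝ (Fin 1)} {r a b : ℝ}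
    (ha : a ≤ x 0) (hb : x 0 ≤ b) (hr : a + r ≤ b)
    {A : Set (EuclideanSpace ℝ (Fin 1))}
    (hA : (fun y : EuclideanSpace ℝ (Fin 1) => y 0) ⁻¹' Set.Icc a b ⊆ A) (hr0 : 0 < r) :
    volume (ball x r) ≤ 2 * volume (ball x r ∩ A) := by
  set c := max a (x 0 - r)
  have hc1 : a ≤ c := le_max_left _ _
  have hc2 : x 0 - r ≤ c := le_max_right _ _
  have hc3 : c ≤ x 0 := max_le ha (by linarith)
  have hc4 : c + r ≤ b := by
    rcases max_choice a (x 0 - r) with h | h <;> simp only [c, h] <;> linarith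
  have hsub : (fun y : EuclideanSpace ℝ (Fin 1) => y 0) ⁻¹' Set.Ioo c (c + r) ⊆
      ball x r ∩ A := by
    refine fun y hy => ⟨?_, hA ⟨hc1.trans hy.1.le, hy.2.le.trans hc4⟩⟩
    rw [ball_eq_preimage_apply_zero]
    exact ⟨hc2.trans_lt hy.1, hy.2.trans_le (by linarith)⟩
  refine le_trans (le_of_eq ?_) (mul_le_mul_right (measure_mono hsub) 2)
  rw [ball_eq_preimage_apply_zero,
    measurePreserving_apply_zero.measure_preimage measurableSet_Ioo.nullMeasurableSet,
    measurePreserving_apply_zero.measure_preimage measurableSet_Ioo.nullMeasurableSet,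
    Real.volume_Ioo, Real.volume_Ioo, add_sub_cancel_left,
    show x 0 + r - (x 0 - r) = 2 * r by ring, ENNReal.ofReal_mul zero_le_two,
    ENNReal.ofReal_ofNat]

/-- On an interval, there are arbitrarily large subsolutions for the median operator. -/
lemma exists_mem_SgLower_one (hΩ : AdmissibleDomain Ω ε) (hc : IsPreconnected Ω)
    (hg : ContinuousOn g (frontier Ω)) {x : EuclideanSpace ℝ (Fin 1)} (hx : x ∈ Ω) (M : ℝ) :
    ∃ v ∈ SgLower 1 ε Ω g, M ≤ v x := by
  obtain ⟨a, b, hab, hΩeq⟩ := exists_eq_preimage_Ioo hΩ hc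
  have hmem : ∀ y, y ∈ Ω ↔ a < y 0 ∧ y 0 < b := fun y => by rw [hΩeq]; rfl
  obtain ⟨L, hL⟩ := hΩ.isCompact_frontier.exists_bound_of_continuousOn hg
  set d : EuclideanSpace ℝ (Fin 1) → ℝ :=
    fun y => min (min (y 0 - a) (b - y 0)) ((b - a) / 4) with hd
  have hdcont : Continuous d := by fun_prop
  have hdx : 0 < d x := by
    obtain ⟨h1, h2⟩ := (hmem x).1 hx
    exact lt_min (lt_min (by linarith) (by linarith)) (by linarith)
  set k := |M + L| / d x with hk
  have hkx : k * d x = |M + L| := div_mul_cancel₀ _ hdx.ne'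
  rcases (div_nonneg (abs_nonneg (M + L)) hdx.le).eq_or_lt with hk0 | hk0
  · refine ⟨fun _ => -L, ⟨continuousOn_const, fun y hy => (muEps_const hΩ le_rfl _ hy).ge,
      fun y hy => (abs_le.1 (hL y hy)).1⟩, ?_⟩
    rw [hk, ← hk0, zero_mul] at hkx
    have := abs_eq_zero.1 hkx.symm
    change M ≤ -L
    linarith
  refine ⟨fun y => -L + k * d y, ⟨by fun_prop, fun y hy => ?_, fun y hy => ?_⟩, ?_⟩
  · have hr := hΩ.rEps_pos hy
    rw [muEps_of_mem hy, le_pMean_iff le_rfl (by simp) hr (by fun_prop), ENNReal.toReal_one,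
      integral_signedPow_one_nonneg_iff (A := {z | d y ≤ d z})
        (isClosed_le continuous_const hdcont).measurableSet]
    · obtain ⟨h1, h2⟩ := (hmem y).1 hy
      have e1 : d y ≤ y 0 - a := (min_le_left _ _).trans (min_le_left _ _)
      have e2 : d y ≤ b - y 0 := (min_le_left _ _).trans (min_le_right _ _)
      have e3 : d y ≤ (b - a) / 4 := min_le_right _ _
      have hrab : 2 * rEps ε Ω y ≤ b - a := by
        have h := hΩ.ball_rEps_subset hy
        have h' : Set.Ioo (y 0 - rEps ε Ω y) (y 0 + rEps ε Ω y) ⊆ Set.Ioo a b := by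
          intro t ht
          have := (hmem (EuclideanSpace.single 0 t)).1 (h (by
            rw [ball_eq_preimage_apply_zero]
            simpa using ht))
          simpa using this
        have := (Set.Ioo_subset_Ioo_iff (by linarith)).1 h'
        linarith [this.1, this.2]
      refine volume_ball_le_two_mul_of_subset (a := a + d y) (b := b - d y)
        (by linarith) (by linarith) (by linarith) (fun z hz => ?_) hr
      obtain ⟨h3, h4⟩ : a + d y ≤ z 0 ∧ z 0 ≤ b - d y := hz
      exact le_min (le_min (by linarith) (by linarith)) e3
    · intro z _
      change d y ≤ d z ↔ -L + k * d y ≤ -L + k * d z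
      rw [add_le_add_iff_left, mul_le_mul_iff_right₀ hk0]
  · have h1 : d y ≤ 0 := by
      have := (hmem y).not.1 (hΩ.notMem_of_mem_frontier hy)
      by_contra! h
      have h2 := h.trans_le ((min_le_left _ _).trans (min_le_left _ _))
      have h3 := h.trans_le ((min_le_left _ _).trans (min_le_right _ _))
      exact this ⟨by linarith, by linarith⟩
    have h2 := (abs_le.1 (hL y hy)).1
    have h3 := mul_nonpos_of_nonneg_of_nonpos hk0.le h1
    change -L + k * d y ≤ g y
    linarith
  · change M ≤ -L + k * d x
    rw [hkx]
    linarith [le_abs_self (M + L)]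

lemma lowerPerron_one_eq_zero (hΩ : AdmissibleDomain Ω ε) (hc : IsPreconnected Ω)
    (hg : ContinuousOn g (frontier Ω)) {x : EuclideanSpace ℝ (Fin 1)} (hx : x ∈ Ω) :
    lowerPerron 1 ε Ω g x = 0 := by
  refine Real.sSup_of_not_bddAbove ?_
  rintro ⟨M, hM⟩
  obtain ⟨v, hv, hvM⟩ := exists_mem_SgLower_one hΩ hc hg hx (M + 1)
  have := hM ⟨v, hv, rfl⟩
  change v x ≤ M at this
  linarith

lemma upperPerron_one_eq_zero (hΩ : AdmissibleDomain Ω ε) (hc : IsPreconnected Ω)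
    (hg : ContinuousOn g (frontier Ω)) {x : EuclideanSpace ℝ (Fin 1)} (hx : x ∈ Ω) :
    upperPerron 1 ε Ω g x = 0 := by
  have h := lowerPerron_eq_neg (g := fun y => -g y) hΩ le_rfl x
  rw [show lowerPerron 1 ε Ω (fun y => -g y) x = 0 from lowerPerron_one_eq_zero hΩ hc hg.neg hx] at h
  simpa using h.symm

end DimensionOne

section Iteration

variable {N : ℕ} {p : ℝ≥0∞} {Ω : Set (EuclideanSpace ℝ (Fin N))} {ε : ℝ}
  {g : EuclideanSpace ℝ (Fin N) → ℝ} (hΩ : AdmissibleDomain Ω ε)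

include hΩ

/-- Away from the one-dimensional median, an upper Perron solution lying below the lower one is a
fixed point of the mean value operator. -/
lemma muEps_upperPerron_eq (hp : 1 ≤ p) (hNp : 2 ≤ N ∨ p ≠ 1) (hg : ContinuousOn g (frontier Ω))
    (heq : ∀ x ∈ closure Ω, lowerPerron p ε Ω g x = upperPerron p ε Ω g x)
    {x : EuclideanSpace ℝ (Fin N)} (hx : x ∈ Ω) :
    muEps p ε Ω (upperPerron p ε Ω g) x = upperPerron p ε Ω g x := by
  have hneg : ∀ y ∈ closure Ω, upperPerron p ε Ω (fun z => -g z) y = -upperPerron p ε Ω g y :=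
    fun y hy => by
      rw [← heq y hy, lowerPerron_eq_neg hΩ hp, neg_neg]
  have hcont : ContinuousOn (upperPerron p ε Ω g) (closure Ω) := by
    refine continuousOn_iff_lower_upperSemicontinuousOn.2
      ⟨fun y hy c hc => ?_, upperSemicontinuousOn_upperPerron hΩ hp hNp hg⟩
    have h := upperSemicontinuousOn_upperPerron hΩ hp hNp hg.neg y hy (-c)
      ((hneg y hy).trans_lt (neg_lt_neg hc))
    filter_upwards [h, self_mem_nhdsWithin] with z hz hzΩ
    exact neg_lt_neg_iff.1 ((hneg z hzΩ).symm.trans_lt hz)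
  have hxc := subset_closure hx
  have key : ∀ h : EuclideanSpace ℝ (Fin N) → ℝ, ContinuousOn h (frontier Ω) →
      ContinuousOn (upperPerron p ε Ω h) (closure Ω) →
      muEps p ε Ω (upperPerron p ε Ω h) x ≤ upperPerron p ε Ω h x := by
    intro h hh hhc
    refine le_csInf ((SgUpper_nonempty hΩ hp hh).image _) ?_
    rintro _ ⟨v, hv, rfl⟩
    exact (muEps_mono hΩ hp hhc hv.1 (fun y hy => upperPerron_le hΩ hp hNp hh hv hy) hx).trans
      (hv.2.1 x hx)
  refine le_antisymm (key g hg hcont) ?_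
  have h := key (fun z => -g z) hg.neg (hcont.neg.congr hneg)
  rw [muEps_congr hΩ (fun y hy => hneg y (subset_closure hy)) hx, muEps_neg hΩ hp hcont hx,
    hneg x hxc] at h
  exact neg_le_neg_iff.1 h

lemma iterate_eq_of_muEps_eq {u : EuclideanSpace ℝ (Fin N) → ℝ}
    (hu : ∀ x ∈ Ω, muEps p ε Ω u x = u x) {W : ℕ → EuclideanSpace ℝ (Fin N) → ℝ}
    (hW0 : ∀ x ∈ closure Ω, W 0 x = u x)
    (hWsucc : ∀ j : ℕ, ∀ x ∈ closure Ω, W (j + 1) x = muEps p ε Ω (W j) x) (j : ℕ) :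
    ∀ x ∈ closure Ω, W j x = u x := by
  induction j with
  | zero => exact hW0
  | succ j ih =>
    intro x hx
    rw [hWsucc j x hx]
    by_cases hxΩ : x ∈ Ω
    · rw [muEps_congr hΩ (fun y hy => ih y (subset_closure hy)) hxΩ, hu x hxΩ]
    · rw [muEps_of_notMem hxΩ, ih x hx]

lemma lowerPerron_eq_upperPerron (hp : 1 ≤ p) (hΩc : IsPreconnected Ω)
    (hg : ContinuousOn g (frontier Ω)) (hreg : ∀ x₀ ∈ frontier Ω, ∃ w, IsBarrier p ε Ω x₀ w)
    (hle : ∀ x ∈ closure Ω, lowerPerron p ε Ω g x ≤ upperPerron p ε Ω g x)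
    {x : EuclideanSpace ℝ (Fin N)} (hx : x ∈ closure Ω) :
    lowerPerron p ε Ω g x = upperPerron p ε Ω g x := by
  rcases ne_or_eq p 1 with hp1 | rfl
  · refine le_antisymm (hle x hx) ?_
    rw [lowerPerron_eq_neg hΩ hp, le_neg_iff_add_nonpos_right]
    exact upperPerron_add_upperPerron_neg_nonpos hΩ hp hp1 hg hreg hx
  rcases (Nat.succ_le_iff.2 hΩ.dim_pos).eq_or_lt with rfl | hN
  · rcases hΩ.mem_or_mem_frontier hx with h | h
    · rw [lowerPerron_one_eq_zero hΩ hΩc hg h, upperPerron_one_eq_zero hΩ hΩc hg h]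
    · rw [lowerPerron_eq_of_mem_frontier hΩ hp hg h (hreg x h),
        upperPerron_eq_of_mem_frontier hΩ hp hg h (hreg x h)]
  · exact le_antisymm (hle x hx) (upperPerron_one_le_lowerPerron hΩ hN hg hreg hle hx)

lemma muEps_upperPerron (hp : 1 ≤ p) (hΩc : IsPreconnected Ω)
    (hg : ContinuousOn g (frontier Ω))
    (heq : ∀ x ∈ closure Ω, lowerPerron p ε Ω g x = upperPerron p ε Ω g x)
    {x : EuclideanSpace ℝ (Fin N)} (hx : x ∈ Ω) :
    muEps p ε Ω (upperPerron p ε Ω g) x = upperPerron p ε Ω g x := by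
  by_cases hNp : 2 ≤ N ∨ p ≠ 1
  · exact muEps_upperPerron_eq hΩ hp hNp hg heq hx
  · obtain ⟨hN, hp1⟩ := not_or.1 hNp
    obtain rfl := not_not.1 hp1
    obtain rfl : N = 1 := by have := hΩ.dim_pos; omega
    rw [muEps_congr hΩ (fun y hy => upperPerron_one_eq_zero hΩ hΩc hg hy) hx,
      muEps_const hΩ hp 0 hx, upperPerron_one_eq_zero hΩ hΩc hg hx]

end Iteration

/-- Corollary 4.6: if all boundary points are regular, then the iteration
`w₁ = w`, `w_{j+1} = μ_p^ε[w_j]`, started at any function `w` squeezed between the lower and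
the upper Perron solutions, converges pointwise on `closure Ω` to the unique solution
`u^ε = u̲^ε = u̅^ε` of the Dirichlet-type problem. -/
theorem iteration_converges_to_perron {N : ℕ} (hN : 0 < N) (p : ℝ≥0∞) (hp : 1 ≤ p)
    (Ω : Set (EuclideanSpace ℝ (Fin N))) (hΩo : IsOpen Ω) (hΩc : IsPreconnected Ω)
    (hΩb : Bornology.IsBounded Ω) (hΩne : Ω.Nonempty)
    (ε : ℝ) (hε : 0 < ε) (z : EuclideanSpace ℝ (Fin N)) (hball : Metric.ball z ε ⊆ Ω)
    (g : EuclideanSpace ℝ (Fin N) → ℝ) (hg : ContinuousOn g (frontier Ω))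
    (hreg : ∀ x₀ ∈ frontier Ω, ∃ w, IsBarrier p ε Ω x₀ w)
    (w : EuclideanSpace ℝ (Fin N) → ℝ)
    (hw : ∀ x ∈ closure Ω, lowerPerron p ε Ω g x ≤ w x ∧ w x ≤ upperPerron p ε Ω g x)
    (W : ℕ → EuclideanSpace ℝ (Fin N) → ℝ)
    (hW0 : ∀ x ∈ closure Ω, W 0 x = w x)
    (hWsucc : ∀ j : ℕ, ∀ x ∈ closure Ω, W (j + 1) x = muEps p ε Ω (W j) x) :
    ∀ x ∈ closure Ω,
      lowerPerron p ε Ω g x = upperPerron p ε Ω g x ∧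
      Tendsto (fun j => W j x) atTop (𝓝 (lowerPerron p ε Ω g x)) := by
  have hΩ : AdmissibleDomain Ω ε := ⟨hN, hΩo, hΩb, hΩne, hε⟩
  have heq : ∀ x ∈ closure Ω, lowerPerron p ε Ω g x = upperPerron p ε Ω g x := fun x hx =>
    lowerPerron_eq_upperPerron hΩ hp hΩc hg hreg (fun y hy => (hw y hy).1.trans (hw y hy).2) hx
  have hW := iterate_eq_of_muEps_eq hΩ (u := upperPerron p ε Ω g)
    (fun x hx => muEps_upperPerron hΩ hp hΩc hg heq hx)
    (fun x hx => (hW0 x hx).trans (le_antisymm (hw x hx).2 (heq x hx ▸ (hw x hx).1))) hWsucc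
  intro x hx
  refine ⟨heq x hx, ?_⟩
  rw [heq x hx]
  exact tendsto_const_nhds.congr fun j => (hW j x hx).symm
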